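/- arXiv:1308.1161 — 3 statements merged into one kernel-verified Lean document; each statement's English description precedes it below -/
import Mathlib

section
/- Feng–Xiang setting; let χ be a multiplicative character of F_q of order N, and let i1, i2, i3 be odd integers such that χ^{i2}χ^{i3} is nontrivial. Then J(χ^{i2}, χ^{i3}) · J(χ^{i1}, χ^{i2}χ^{i3}) = G_q(χ^{i1}) G_q(χ^{i2}) G_q(χ^{i3}) / G_q(χ^{i1}χ^{i2}χ^{i3}) = ((−1)^{((p−1)/2)·((f−1)/2)} p^{(f−1)/2} √p*)^{2s}, where p* = (−1)^{(p−1)/2} p and √p* is a complex square root of p*; in particular p divides J(χ^{i2}, χ^{i3}) · J(χ^{i1}, χ^{i2}χ^{i3}) in the ring of algebraic integers. -/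
/-- The Gauss sum `G_q(χ) = Σ_{x∈𝔽_q^*} χ(x) ψ(x)` of a multiplicative character `χ`,
where `ψ(x) = ζ_p^{Tr_{q/p}(x)}` is the canonical additive character of `𝔽_q`
(`ζ_p = exp(2πi/p)`). -/
noncomputable def gaussSumC (p : ℕ) (F : Type*) [Field F] [Fintype F]
    [Algebra (ZMod p) F] (χ : MulChar F ℂ) : ℂ :=
  ∑ x : F, χ x *
    Complex.exp (2 * Real.pi * Complex.I * ((Algebra.trace (ZMod p) F x).val : ℂ) / p)

lemma fx_two_pow (p1 m N p f : ℕ)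
    (hp1 : p1.Prime) (hp1mod : p1 % 8 = 7) (hm : 1 ≤ m) (hN : N = 2 * p1 ^ m)
    (hpmod : p % 4 = 3) (hf : f = p1 ^ (m - 1) * ((p1 - 1) / 2))
    (hord : orderOf (p : ZMod N) = f) : ∃ j : ℕ, p ^ j ≡ 2 [MOD p1 ^ m] := by
  classical
  have hp1' : Fact p1.Prime := ⟨hp1⟩
  have hp7 : 7 ≤ p1 := by omega
  have hfpos : 0 < f := by
    rw [hf]; exact Nat.mul_pos (pow_pos hp1.pos _) (by omega)
  have hMpos : 0 < p1 ^ m := pow_pos hp1.pos _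
  have key : ∀ k : ℕ, p ^ k ≡ 1 [MOD p1 ^ m] → f ∣ k := by
    intro k hk
    rw [← hord]
    apply orderOf_dvd_of_pow_eq_one
    have h2 : p ^ k ≡ 1 [MOD 2] := by
      have : p ≡ 1 [MOD 2] := by unfold Nat.ModEq; omega
      simpa using this.pow k
    have hc : Nat.Coprime 2 (p1 ^ m) := by
      apply Nat.Coprime.pow_right
      exact (Nat.coprime_primes Nat.prime_two hp1).2 (by omega)
    have h3 := (Nat.modEq_and_modEq_iff_modEq_mul hc).1 ⟨h2, hk⟩
    rw [← hN] at h3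
    have := (ZMod.natCast_eq_natCast_iff _ _ _).2 h3
    simpa using this
  have hpf : p ^ f ≡ 1 [MOD p1 ^ m] := by
    have h : ((p : ZMod N)) ^ f = 1 := by rw [← hord]; exact pow_orderOf_eq_one _
    have h' : ((p ^ f : ℕ) : ZMod N) = ((1 : ℕ) : ZMod N) := by simpa using h
    have h3 := (ZMod.natCast_eq_natCast_iff _ _ _).1 h'
    rw [hN] at h3
    exact Nat.ModEq.of_mul_left 2 h3
  have hcop : Nat.Coprime p (p1 ^ m) := by
    have : Nat.gcd (p ^ f) (p1 ^ m) = 1 := by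
      have := hpf.gcd_eq
      simpa using this
    exact (Nat.coprime_pow_left_iff hfpos p _).1 this
  have hcop2 : Nat.Coprime 2 (p1 ^ m) := by
    apply Nat.Coprime.pow_right
    exact (Nat.coprime_primes Nat.prime_two hp1).2 (by omega)
  have : NeZero (p1 ^ m) := ⟨hMpos.ne'⟩
  have hcyc : IsCyclic (ZMod (p1 ^ m))ˣ := ZMod.isCyclic_units_of_prime_pow p1 hp1 (by omega) m
  set u := ZMod.unitOfCoprime p hcop with hu
  set t := ZMod.unitOfCoprime 2 hcop2 with ht
  have huord : orderOf u = f := by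
    apply Nat.dvd_antisymm
    · apply orderOf_dvd_of_pow_eq_one
      ext
      have := (ZMod.natCast_eq_natCast_iff _ _ _).2 hpf
      simpa [hu] using this
    · apply key
      have h : u ^ orderOf u = 1 := pow_orderOf_eq_one u
      have h' := congrArg (fun x : (ZMod (p1 ^ m))ˣ => (x : ZMod (p1 ^ m))) h
      apply (ZMod.natCast_eq_natCast_iff _ _ _).1
      rw [Nat.cast_pow, Nat.cast_one]
      exact h'
  have htf : t ^ f = 1 := by
    have hsq : IsSquare (2 : ZMod p1) := (ZMod.exists_sq_eq_two_iff (by omega)).2 (Or.inr hp1mod)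
    have h20 : (2 : ZMod p1) ≠ 0 := by
      intro h
      have : ((2 : ℕ) : ZMod p1) = 0 := by exact_mod_cast h
      rw [ZMod.natCast_eq_zero_iff] at this
      have := Nat.le_of_dvd (by norm_num) this
      omega
    have h1 := (ZMod.euler_criterion p1 h20).1 hsq
    have h2 : ((p1 : ℕ) : ℤ) ∣ 2 ^ (p1 / 2) - 1 := by
      rw [← ZMod.intCast_zmod_eq_zero_iff_dvd]
      push_cast
      rw [h1, sub_self]
    have h3 := dvd_sub_pow_of_dvd_sub h2 (m - 1)
    rw [Nat.sub_add_cancel hm, one_pow, ← pow_mul] at h3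
    have h4 : p1 / 2 * p1 ^ (m - 1) = f := by
      rw [hf, mul_comm]; congr 1; omega
    rw [h4] at h3
    have h5 : (((2 : ℤ) ^ f - 1 : ℤ) : ZMod (p1 ^ m)) = 0 := by
      rw [ZMod.intCast_zmod_eq_zero_iff_dvd]
      exact_mod_cast h3
    ext
    push_cast at h5
    simpa [ht] using sub_eq_zero.1 h5
  have hmem : t ∈ Subgroup.zpowers u := by
    have hle := IsCyclic.card_pow_eq_one_le (α := (ZMod (p1 ^ m))ˣ) hfpos
    have hsub : (Finset.univ.filter fun a : (ZMod (p1 ^ m))ˣ => a ∈ Subgroup.zpowers u) ⊆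
        Finset.univ.filter fun a : (ZMod (p1 ^ m))ˣ => a ^ f = 1 := by
      intro a ha
      simp only [Finset.mem_filter, Finset.mem_univ, true_and] at ha ⊢
      obtain ⟨k, rfl⟩ := Subgroup.mem_zpowers_iff.1 ha
      rw [← zpow_natCast, ← zpow_mul, mul_comm, zpow_mul, zpow_natCast, ← huord,
        pow_orderOf_eq_one, one_zpow]
    have hcard : (Finset.univ.filter fun a : (ZMod (p1 ^ m))ˣ => a ∈ Subgroup.zpowers u).card
        = f := by
      rw [← huord, ← Nat.card_zpowers, Nat.card_eq_fintype_card, ← Fintype.card_subtype]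
    have heq := Finset.eq_of_subset_of_card_le hsub (by rw [hcard]; exact hle)
    have : t ∈ Finset.univ.filter fun a : (ZMod (p1 ^ m))ˣ => a ^ f = 1 := by simp [htf]
    rw [← heq] at this
    simpa using this
  obtain ⟨j, hj⟩ := mem_powers_iff_mem_zpowers.2 hmem
  refine ⟨j, ?_⟩
  have hcoe := congrArg (fun x : (ZMod (p1 ^ m))ˣ => (x : ZMod (p1 ^ m))) hj
  apply (ZMod.natCast_eq_natCast_iff _ _ _).1
  simpa [hu, ht] using hcoe

/-- The duplication identity for Jacobi sums. -/
lemma fx_duplication (F : Type*) [Field F] [Fintype F] [DecidableEq F] (h2 : ringChar F ≠ 2)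
    (ρ η : MulChar F ℂ) (hρ : ρ ≠ 1) (hη : ∀ a, η a = ((quadraticChar F a : ℤ) : ℂ)) :
    ρ 4 * jacobiSum ρ ρ = jacobiSum ρ η := by
  have h20 : (2 : F) ≠ 0 := Ring.two_ne_zero h2
  have e1 : ρ 4 * jacobiSum ρ ρ = ∑ y : F, ρ (1 - y ^ 2) := by
    unfold jacobiSum
    rw [Finset.mul_sum]
    let e : F ≃ F :=
      { toFun := fun x => 1 - 2 * x
        invFun := fun y => (1 - y) / 2
        left_inv := fun x => by field_simp; ring
        right_inv := fun y => by field_simp; ring }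
    rw [← e.sum_comp (fun y => ρ (1 - y ^ 2))]
    refine Finset.sum_congr rfl fun x _ => ?_
    rw [← map_mul, ← map_mul]
    congr 1
    simp only [e, Equiv.coe_fn_mk]
    ring
  have e2 : ∑ y : F, ρ (1 - y ^ 2) = ∑ v : F, ρ (1 - v) * (η v + 1) := by
    rw [← Finset.sum_fiberwise (s := Finset.univ) (g := fun y : F => y ^ 2)]
    refine Finset.sum_congr rfl fun v _ => ?_
    rw [Finset.sum_congr rfl (g := fun _ => ρ (1 - v))]
    · rw [Finset.sum_const, nsmul_eq_mul, mul_comm]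
      congr 1
      have := quadraticChar_card_sqrts h2 v
      rw [hη]
      have h' : ((({x : F | x ^ 2 = v} : Set F).toFinset.card : ℤ) : ℂ)
        = ((quadraticChar F v + 1 : ℤ) : ℂ) := by rw [this]
      push_cast at h'
      rw [← h']
      congr 2
      ext x
      simp
    · intro y hy
      simp only [Finset.mem_filter, Finset.mem_univ, true_and] at hy
      rw [hy]
  have e3 : ∑ v : F, ρ (1 - v) = 0 := by
    refine ((Equiv.subLeft (1 : F)).sum_comp (fun v => ρ v)).trans ?_
    exact MulChar.sum_eq_zero_of_ne_one hρ
  rw [e1, e2, jacobiSum_comm]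
  simp only [mul_add, mul_one, Finset.sum_add_distrib, e3, add_zero]
  unfold jacobiSum
  exact Finset.sum_congr rfl fun v _ => mul_comm _ _

lemma fx_quad (F : Type*) [Field F] [Fintype F] [DecidableEq F]
    (hq : Fintype.card F % 4 = 3) (h2 : ringChar F ≠ 2)
    (η : MulChar F ℂ) (hη1 : η ≠ 1) (hη2 : η ^ 2 = 1) :
    η (-1) = -1 ∧ ∀ a, η a = ((quadraticChar F a : ℤ) : ℂ) := by
  have hodd : Odd (Fintype.card F / 2) := by rw [Nat.odd_iff]; omega
  have hsq : ∀ a : F, a ≠ 0 → η a = 1 ∨ η a = -1 := by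
    intro a ha
    have : (η ^ 2) a = 1 := by rw [hη2, MulChar.one_apply (isUnit_iff_ne_zero.2 ha)]
    rw [MulChar.pow_apply' _ (by norm_num)] at this
    exact sq_eq_one_iff.1 this
  have hm1 : η (-1) = -1 := by
    obtain ⟨u, hu⟩ := MulChar.ne_one_iff.1 hη1
    have h1 := (hsq u u.ne_zero).resolve_left hu
    rcases FiniteField.pow_dichotomy h2 u.ne_zero with h | h
    · have := congrArg η h
      rw [map_pow, h1, hodd.neg_one_pow, map_one] at this
      norm_num at this
    · rw [← h, map_pow, h1, hodd.neg_one_pow]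
  refine ⟨hm1, fun a => ?_⟩
  by_cases ha : a = 0
  · subst ha
    rw [MulChar.map_zero]; simp
  by_cases hs : IsSquare a
  · rw [(quadraticChar_one_iff_isSquare ha).2 hs]
    obtain ⟨b, rfl⟩ := hs
    have hb : b ≠ 0 := by rintro rfl; simp at ha
    rw [map_mul]
    rcases hsq b hb with h | h <;> simp [h]
  · rw [quadraticChar_neg_one_iff_not_isSquare.2 hs]
    rcases FiniteField.pow_dichotomy h2 ha with h | h
    · exact absurd ((FiniteField.isSquare_iff h2 ha).2 h) hs
    · rcases hsq a ha with h' | h'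
      · have := congrArg η h
        rw [map_pow, h', one_pow, hm1] at this
        norm_num at this
      · rw [h']; simp

/-- The canonical additive character. -/
noncomputable def fxPsi (p : ℕ) [Fact p.Prime] (F : Type*) [Field F] [Fintype F]
    [Algebra (ZMod p) F] : AddChar F ℂ :=
  (ZMod.stdAddChar (N := p)).compAddMonoidHom (Algebra.trace (ZMod p) F).toAddMonoidHom

lemma fxPsi_apply (p : ℕ) [Fact p.Prime] (F : Type*) [Field F] [Fintype F]
    [Algebra (ZMod p) F] (x : F) :
    fxPsi p F x = ZMod.stdAddChar (Algebra.trace (ZMod p) F x) := rfl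

lemma fx_gauss (p : ℕ) [Fact p.Prime] (F : Type*) [Field F] [Fintype F]
    [Algebra (ZMod p) F] (χ : MulChar F ℂ) : gaussSumC p F χ = gaussSum χ (fxPsi p F) := by
  unfold gaussSumC gaussSum
  refine Finset.sum_congr rfl fun x _ => ?_
  rw [fxPsi_apply, ZMod.stdAddChar_apply, ZMod.toCircle_apply]

lemma fxPsi_primitive (p : ℕ) [Fact p.Prime] (F : Type*) [Field F] [Fintype F]
    [Algebra (ZMod p) F] : (fxPsi p F).IsPrimitive := by
  apply AddChar.IsPrimitive.of_ne_one
  intro h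
  obtain ⟨x, hx⟩ := Algebra.trace_surjective (ZMod p) F 1
  have h1 : fxPsi p F x = 1 := by rw [h]; rfl
  rw [fxPsi_apply, hx] at h1
  have h3 : (1 : ZMod p) = 0 := ZMod.injective_stdAddChar (by rw [h1, AddChar.map_zero_eq_one])
  exact one_ne_zero h3

lemma fx_frob (p : ℕ) [Fact p.Prime] (F : Type*) [Field F] [Fintype F]
    [Algebra (ZMod p) F] (χ : MulChar F ℂ) :
    gaussSum (χ ^ p) (fxPsi p F) = gaussSum χ (fxPsi p F) := by
  unfold gaussSum
  have hp : p.Prime := Fact.out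
  rw [← (FiniteField.frobeniusAlgEquivOfAlgebraic (ZMod p) F).toEquiv.sum_comp
    (fun a => χ a * fxPsi p F a)]
  refine Finset.sum_congr rfl fun x _ => ?_
  have : (FiniteField.frobeniusAlgEquivOfAlgebraic (ZMod p) F) x = x ^ p := by
    rw [FiniteField.coe_frobeniusAlgEquivOfAlgebraic, ZMod.card]
  have h2 : fxPsi p F ((FiniteField.frobeniusAlgEquivOfAlgebraic (ZMod p) F) x)
      = fxPsi p F x := by
    rw [fxPsi_apply, fxPsi_apply, Algebra.trace_eq_of_algEquiv]
  change (χ ^ p) x * _ = χ ((FiniteField.frobeniusAlgEquivOfAlgebraic (ZMod p) F) x) *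
    fxPsi p F ((FiniteField.frobeniusAlgEquivOfAlgebraic (ZMod p) F) x)
  rw [h2, this, MulChar.pow_apply' _ hp.ne_zero, map_pow]

lemma fx_frob_pow (p : ℕ) [Fact p.Prime] (F : Type*) [Field F] [Fintype F]
    [Algebra (ZMod p) F] (χ : MulChar F ℂ) (j : ℕ) :
    gaussSum (χ ^ p ^ j) (fxPsi p F) = gaussSum χ (fxPsi p F) := by
  induction j with
  | zero => simp
  | succ k ih => rw [pow_succ, pow_mul, fx_frob, ih]

/-- The index two evaluation: if `ρ² = ρ^{p^j}` then `G(ρη) = G(η)`. -/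
lemma fx_eval (p : ℕ) [Fact p.Prime] (F : Type*) [Field F] [Fintype F] [DecidableEq F]
    [Algebra (ZMod p) F] (h2 : ringChar F ≠ 2)
    (ρ η : MulChar F ℂ) (hη : ∀ a, η a = ((quadraticChar F a : ℤ) : ℂ))
    (j : ℕ) (hj : ρ ^ 2 = ρ ^ p ^ j) (hρη : ρ * η ≠ 1) (hρ2 : ρ ≠ 1 → ρ ^ 2 ≠ 1) :
    gaussSum (ρ * η) (fxPsi p F) = gaussSum η (fxPsi p F) := by
  have hp : p.Prime := Fact.out
  by_cases hρ : ρ = 1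
  · rw [hρ, one_mul]
  have h20 : (2 : F) ≠ 0 := Ring.two_ne_zero h2
  have hchar : CharP F p := charP_of_injective_algebraMap (algebraMap (ZMod p) F).injective p
  have hr2 : ρ 2 = 1 := by
    have h : (ρ ^ 2) 2 = (ρ ^ p ^ j) 2 := by rw [hj]
    rw [MulChar.pow_apply' _ (by norm_num), MulChar.pow_apply' _ (pow_pos hp.pos _).ne',
      ← map_pow ρ 2 (p ^ j)] at h
    have h2p : (2 : F) ^ p ^ j = 2 := by
      have := map_ofNat (iterateFrobenius F p j) 2
      rwa [iterateFrobenius_def] at this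
    rw [h2p, sq] at h
    have hne : ρ 2 ≠ 0 := ((isUnit_iff_ne_zero.2 h20).map ρ).ne_zero
    exact mul_right_cancel₀ hne (by rw [h, one_mul])
  have hr4 : ρ 4 = 1 := by
    rw [show (4 : F) = 2 * 2 by norm_num, map_mul, hr2, one_mul]
  have hd := fx_duplication F h2 ρ η hρ hη
  rw [hr4, one_mul] at hd
  have hJ1 := jacobiSum_mul_nontrivial (χ := ρ) (φ := ρ) (by rw [← sq]; exact hρ2 hρ) (fxPsi p F)
  have hJ2 := jacobiSum_mul_nontrivial hρη (fxPsi p F)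
  have hcard : ((Fintype.card F : ℕ) : ℂ) ≠ 0 := by
    exact_mod_cast Fintype.card_ne_zero
  have hG : gaussSum ρ (fxPsi p F) ≠ 0 :=
    gaussSum_ne_zero_of_nontrivial hcard hρ (fxPsi_primitive p F)
  rw [← sq, hj, fx_frob_pow] at hJ1
  have hJ3 := mul_left_cancel₀ hG hJ1
  rw [← hd, hJ3, mul_comm] at hJ2
  exact mul_left_cancel₀ hG hJ2

/-- Remark 2.6: in the Feng–Xiang setting, for `χ` of order `N` on `𝔽_q` and odd
`i₁, i₂, i₃` with `χ^{i₂}χ^{i₃}` nontrivial,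
`J(χ^{i₂},χ^{i₃}) J(χ^{i₁},χ^{i₂}χ^{i₃})
  = G(χ^{i₁})G(χ^{i₂})G(χ^{i₃})/G(χ^{i₁}χ^{i₂}χ^{i₃})
  = ((-1)^{((p-1)/2)((f-1)/2)} p^{(f-1)/2} √p*)^{2s}`, with `p* = (-1)^{(p-1)/2} p`;
in particular `p` divides the product of the two Jacobi sums in the ring of algebraic
integers. -/
theorem jacobi_product_value_feng_xiang
    (p1 m N p f s q : ℕ)
    (hp1 : p1.Prime) (hp1mod : p1 % 8 = 7) (hm : 1 ≤ m) (hN : N = 2 * p1 ^ m)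
    (hp : p.Prime) (hpmod : p % 4 = 3)
    (hf : f = N.totient / 2) (hord : orderOf (p : ZMod N) = f)
    (hs : Odd s) (hq : q = p ^ (f * s))
    (F : Type*) [Field F] [Fintype F] [Algebra (ZMod p) F]
    (hF : Fintype.card F = q)
    (χ : MulChar F ℂ) (hχ : orderOf χ = N)
    (i1 i2 i3 : ℕ) (h1 : Odd i1) (h2 : Odd i2) (h3 : Odd i3)
    (h23 : χ ^ (i2 + i3) ≠ 1)
    (sp : ℂ) (hsp : sp ^ 2 = (-1 : ℂ) ^ ((p - 1) / 2) * p) :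
    jacobiSum (χ ^ i2) (χ ^ i3) * jacobiSum (χ ^ i1) (χ ^ (i2 + i3)) =
        gaussSumC p F (χ ^ i1) * gaussSumC p F (χ ^ i2) * gaussSumC p F (χ ^ i3) /
          gaussSumC p F (χ ^ (i1 + i2 + i3)) ∧
      jacobiSum (χ ^ i2) (χ ^ i3) * jacobiSum (χ ^ i1) (χ ^ (i2 + i3)) =
        ((-1 : ℂ) ^ (((p - 1) / 2) * ((f - 1) / 2)) * (p : ℂ) ^ ((f - 1) / 2) * sp) ^
          (2 * s) ∧
      ∃ w : ℂ, IsIntegral ℤ w ∧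
        jacobiSum (χ ^ i2) (χ ^ i3) * jacobiSum (χ ^ i1) (χ ^ (i2 + i3)) = p * w := by
  classical
  have : Fact p.Prime := ⟨hp⟩
  have hp1' : Fact p1.Prime := ⟨hp1⟩
  have hMpos : 0 < p1 ^ m := pow_pos hp1.pos _
  have hModd : Odd (p1 ^ m) := Odd.pow (by rw [Nat.odd_iff]; omega)
  have hf' : f = p1 ^ (m - 1) * ((p1 - 1) / 2) := by
    have hc : Nat.Coprime 2 (p1 ^ m) := Nat.coprime_two_left.2 hModd
    rw [hf, hN, Nat.totient_mul hc, Nat.totient_two, one_mul, Nat.totient_prime_pow hp1 hm,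
      Nat.mul_div_assoc _ (by omega)]
  have hfodd : Odd f := by
    rw [hf']
    exact (Odd.pow (by rw [Nat.odd_iff]; omega)).mul (by rw [Nat.odd_iff]; omega)
  obtain ⟨j, hj⟩ := fx_two_pow p1 m N p f hp1 hp1mod hm hN hpmod hf' hord
  have hcard4 : Fintype.card F % 4 = 3 := by
    rw [hF, hq, Nat.pow_mod, hpmod]
    obtain ⟨k, hk⟩ := hfodd.mul hs
    rw [hk, pow_succ, pow_mul, Nat.mul_mod, Nat.pow_mod]
    norm_num
  have hch : ringChar F ≠ 2 := by
    intro h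
    have := FiniteField.even_card_iff_char_two.1 h
    omega
  have hcard : ((Fintype.card F : ℕ) : ℂ) ≠ 0 := by
    exact_mod_cast Fintype.card_ne_zero
  set M := p1 ^ m with hM
  have hNeven : 2 ∣ N := ⟨M, hN⟩
  have hne : ∀ i : ℕ, Odd i → χ ^ i ≠ 1 := by
    intro i hi h
    have := orderOf_dvd_of_pow_eq_one h
    rw [hχ] at this
    have h3 := hNeven.trans this
    rw [Nat.odd_iff] at hi
    omega
  have hη2 : (χ ^ M) ^ 2 = 1 := by
    rw [← pow_mul, mul_comm, ← hN, ← hχ, pow_orderOf_eq_one]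
  obtain ⟨hηm1, hηq⟩ := fx_quad F hcard4 hch (χ ^ M) (hne M hModd) hη2
  set ψ := fxPsi p F with hψ
  have hval : ∀ i : ℕ, Odd i → gaussSum (χ ^ i) ψ = gaussSum (χ ^ M) ψ := by
    intro i hi
    have hprod : χ ^ (i + M) * χ ^ M = χ ^ i := by
      rw [pow_add, mul_assoc, ← sq, hη2, mul_one]
    have hρM : (χ ^ (i + M)) ^ M = 1 := by
      obtain ⟨k, hk⟩ := hi.add_odd hModd
      rw [hk, ← pow_mul, show (k + k) * M = N * k by rw [hN]; ring, pow_mul, ← hχ,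
        pow_orderOf_eq_one, one_pow]
    have hdvd := orderOf_dvd_of_pow_eq_one hρM
    have hpow : (χ ^ (i + M)) ^ 2 = (χ ^ (i + M)) ^ p ^ j :=
      pow_eq_pow_iff_modEq.2 (hj.of_dvd hdvd).symm
    rw [← hprod]
    refine fx_eval p F hch _ _ hηq j hpow (by rw [hprod]; exact hne i hi) ?_
    intro h1 h2'
    apply h1
    obtain ⟨k, hk⟩ := hModd
    have h5 := pow_succ (χ ^ (i + M)) (2 * k)
    rw [← hk, hρM, pow_mul, h2', one_pow, one_mul] at h5
    exact h5.symm
  have hgsq : gaussSum (χ ^ M) ψ ^ 2 = -(q : ℂ) := by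
    have hquad : (χ ^ M).IsQuadratic := by
      intro a
      rw [hηq]
      rcases quadraticChar_isQuadratic F a with h | h | h <;> simp [h]
    rw [gaussSum_sq (hne M hModd) hquad (fxPsi_primitive p F), hηm1, hF]
    ring
  have hodd123 : Odd (i1 + i2 + i3) := (h1.add_odd h2).add_odd h3
  have hg0 : gaussSum (χ ^ M) ψ ≠ 0 :=
    gaussSum_ne_zero_of_nontrivial hcard (hne M hModd) (fxPsi_primitive p F)
  have hJ1 := jacobiSum_mul_nontrivial (χ := χ ^ i2) (φ := χ ^ i3)
    (by rw [← pow_add]; exact h23) ψ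
  have hJ2 := jacobiSum_mul_nontrivial (χ := χ ^ i1) (φ := χ ^ (i2 + i3))
    (by rw [← pow_add, ← add_assoc]; exact hne _ hodd123) ψ
  have h23g : gaussSum (χ ^ (i2 + i3)) ψ ≠ 0 :=
    gaussSum_ne_zero_of_nontrivial hcard h23 (fxPsi_primitive p F)
  rw [← pow_add] at hJ1
  rw [← pow_add, ← add_assoc] at hJ2
  have hfirst : jacobiSum (χ ^ i2) (χ ^ i3) * jacobiSum (χ ^ i1) (χ ^ (i2 + i3)) =
        gaussSumC p F (χ ^ i1) * gaussSumC p F (χ ^ i2) * gaussSumC p F (χ ^ i3) /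
          gaussSumC p F (χ ^ (i1 + i2 + i3)) := by
    simp only [fx_gauss]
    rw [← hψ, eq_div_iff (by rw [hval _ hodd123]; exact hg0)]
    apply mul_left_cancel₀ h23g
    linear_combination (gaussSum (χ ^ (i1 + i2 + i3)) ψ * jacobiSum (χ ^ i1) (χ ^ (i2 + i3))) * hJ1
      + gaussSum (χ ^ i2) ψ * gaussSum (χ ^ i3) ψ * hJ2
  have hvalue : jacobiSum (χ ^ i2) (χ ^ i3) * jacobiSum (χ ^ i1) (χ ^ (i2 + i3)) = -(q : ℂ) := by
    rw [hfirst]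
    simp only [fx_gauss]
    rw [← hψ, hval _ h1, hval _ h2, hval _ h3, hval _ hodd123, ← hgsq]
    field_simp
  refine ⟨hfirst, ?_, ?_⟩
  · rw [hvalue, pow_mul _ 2 s, mul_pow _ sp, mul_pow _ _ 2, hsp, ← pow_mul, ← pow_mul, mul_comm _ 2, pow_mul,
      neg_one_sq, one_pow, one_mul]
    have ho : Odd ((p - 1) / 2) := by rw [Nat.odd_iff]; omega
    rw [ho.neg_one_pow]
    obtain ⟨k, hk⟩ := hfodd
    have hk' : (f - 1) / 2 * 2 + 1 = f := by omega
    rw [show (p : ℂ) ^ ((f - 1) / 2 * 2) * (-1 * p) = -((p : ℂ) ^ ((f - 1) / 2 * 2 + 1)) by ring,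
      hk', hs.neg_pow, ← pow_mul, hq]
    push_cast
    rfl
  · refine ⟨-((p ^ (f * s - 1) : ℕ) : ℂ), ?_, ?_⟩
    · have h5 := (isIntegral_algebraMap (R := ℤ) (A := ℂ) (x := ((p ^ (f * s - 1) : ℕ) : ℤ))).neg
      simpa using h5
    · rw [hvalue, hq]
      have : f * s - 1 + 1 = f * s := Nat.sub_add_cancel (hfodd.mul hs).pos
      nth_rw 1 [← this]
      push_cast
      ring
end

section
/- Let χ be a nontrivial multiplicative character of F_q, q = p^f, let s ≥ 1, and let χ' be the lift of χ to F_{q^s}, defined by χ'(α) = χ(Norm_{F_{q^s}/F_q}(α)) for α ∈ F_{q^s}^*. Then G_{q^s}(χ') = (−1)^{s−1} (G_q(χ))^s. -/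
open Polynomial UniqueFactorizationMonoid

namespace DH

variable {F : Type*} [Field F]

/-- The multiplicative function on monic polynomials. -/
noncomputable def lam (χ : MulChar F ℂ) (ψ : AddChar F ℂ) (g : F[X]) : ℂ :=
  χ ((-1) ^ g.natDegree * g.coeff 0) * ψ (-g.nextCoeff)

lemma lam_mul (χ : MulChar F ℂ) (ψ : AddChar F ℂ) {g h : F[X]} (hg : g.Monic) (hh : h.Monic) :
    lam χ ψ (g * h) = lam χ ψ g * lam χ ψ h := by
  unfold lam
  rw [hg.natDegree_mul hh, hg.nextCoeff_mul hh, mul_coeff_zero, neg_add, AddChar.map_add_eq_mul,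
    show (-1 : F) ^ (g.natDegree + h.natDegree) * (g.coeff 0 * h.coeff 0) =
      ((-1) ^ g.natDegree * g.coeff 0) * ((-1) ^ h.natDegree * h.coeff 0) by ring, map_mul]
  ring

lemma lam_one (χ : MulChar F ℂ) (ψ : AddChar F ℂ) : lam χ ψ 1 = 1 := by
  simp [lam, nextCoeff]

lemma lam_pow (χ : MulChar F ℂ) (ψ : AddChar F ℂ) {g : F[X]} (hg : g.Monic) (k : ℕ) :
    lam χ ψ (g ^ k) = lam χ ψ g ^ k := by
  induction k with
  | zero => simp [lam_one]
  | succ k ih => rw [pow_succ, lam_mul χ ψ (hg.pow k) hg, ih, pow_succ]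

lemma finite_monics [Finite F] (n : ℕ) : {g : F[X] | g.Monic ∧ g.natDegree = n}.Finite := by
  have : Finite (degreeLT F (n + 1)) := Finite.of_equiv _ (degreeLTEquiv F (n + 1)).symm.toEquiv
  refine Set.Finite.subset (Set.toFinite (degreeLT F (n + 1) : Set F[X])) ?_
  rintro g ⟨hg, rfl⟩
  simp only [SetLike.mem_coe, mem_degreeLT]
  rw [degree_eq_natDegree hg.ne_zero]
  exact_mod_cast Nat.lt_succ_self _

/-- Monic polynomials of degree `n`. -/
noncomputable def monics (F : Type*) [Field F] [Finite F] (n : ℕ) : Finset F[X] :=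
  (finite_monics (F := F) n).toFinset

lemma mem_monics [Finite F] {n : ℕ} {g : F[X]} :
    g ∈ monics F n ↔ g.Monic ∧ g.natDegree = n := by simp [monics]

open Classical in
/-- Monic irreducible polynomials of degree at most `N`. -/
noncomputable def irr (F : Type*) [Field F] [Finite F] (N : ℕ) : Finset F[X] :=
  ((Finset.range (N + 1)).biUnion (monics F)).filter Irreducible

lemma mem_irr [Finite F] {N : ℕ} {g : F[X]} :
    g ∈ irr F N ↔ g.Monic ∧ Irreducible g ∧ g.natDegree ≤ N := by
  simp [irr, mem_monics]
  grind

/-- The sum of `lam` over monic polynomials. -/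
noncomputable def S [Finite F] (χ : MulChar F ℂ) (ψ : AddChar F ℂ) (n : ℕ) : ℂ :=
  ∑ g ∈ monics F n, lam χ ψ g

lemma S_zero [Finite F] (χ : MulChar F ℂ) (ψ : AddChar F ℂ) : S χ ψ 0 = 1 := by
  have : monics F 0 = {1} := by
    ext g
    rw [mem_monics, Finset.mem_singleton]
    constructor
    · rintro ⟨h1, h2⟩
      exact h1.natDegree_eq_zero.mp h2
    · rintro rfl
      simp [monic_one]
  simp [S, this, lam_one]

lemma S_one [Fintype F] (χ : MulChar F ℂ) (ψ : AddChar F ℂ) :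
    S χ ψ 1 = ∑ x : F, χ x * ψ x := by
  symm
  refine Finset.sum_bij (fun x _ => X - C x) ?_ ?_ ?_ ?_
  · intro x _
    simp [mem_monics, monic_X_sub_C]
  · intro x _ y _ h
    simpa using h
  · intro g hg
    obtain ⟨h1, h2⟩ := mem_monics.mp hg
    refine ⟨-g.coeff 0, Finset.mem_univ _, ?_⟩
    have := h1.eq_X_add_C h2
    rw [this]
    simp
  · intro x _
    simp [lam, nextCoeff_X_sub_C]

lemma S_eq_zero [Finite F] (χ : MulChar F ℂ) (ψ : AddChar F ℂ) (hψ : ψ ≠ 1) {n : ℕ}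
    (hn : 2 ≤ n) : S χ ψ n = 0 := by
  obtain ⟨c, hc⟩ := (AddChar.ne_one_iff).mp hψ
  have key : ∀ (d : F) (g : F[X]), g ∈ monics F n →
      (g + C d * X ^ (n - 1)) ∈ monics F n ∧
      lam χ ψ (g + C d * X ^ (n - 1)) = ψ (-d) * lam χ ψ g := by
    intro d g hg
    obtain ⟨h1, h2⟩ := mem_monics.mp hg
    have hdeg : (C d * X ^ (n - 1)).degree < g.degree := by
      refine (degree_C_mul_X_pow_le _ _).trans_lt ?_
      rw [degree_eq_natDegree h1.ne_zero, h2]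
      exact_mod_cast (by omega)
    have hnd : (g + C d * X ^ (n - 1)).natDegree = n := by
      rw [natDegree_add_eq_left_of_degree_lt hdeg, h2]
    refine ⟨mem_monics.mpr ⟨h1.add_of_left hdeg, hnd⟩, ?_⟩
    unfold lam
    rw [hnd, h2, nextCoeff_of_natDegree_pos (by omega), nextCoeff_of_natDegree_pos (by omega),
      hnd, h2]
    simp only [coeff_add, coeff_C_mul, coeff_X_pow]
    rw [if_neg (by omega), if_pos trivial, mul_one, mul_zero, add_zero, neg_add,
      AddChar.map_add_eq_mul]
    ring
  have h : S χ ψ n = ψ c * S χ ψ n := by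
    conv_rhs => rw [S, Finset.mul_sum]
    symm
    refine Finset.sum_bij' (fun g _ => g + C (-c) * X ^ (n - 1))
      (fun g _ => g + C c * X ^ (n - 1)) ?_ ?_ ?_ ?_ ?_
    · intro g hg; exact (key _ g hg).1
    · intro g hg; exact (key _ g hg).1
    · intro g hg; simp
    · intro g hg; simp
    · intro g hg; rw [(key _ g hg).2, neg_neg]
  have h2 : (ψ c - 1) * S χ ψ n = 0 := by linear_combination -h
  exact (mul_eq_zero.mp h2).resolve_left (sub_ne_zero.mpr hc)

open Classical in
lemma sum_dvd [Finite F] (χ : MulChar F ℂ) (ψ : AddChar F ℂ) (n : ℕ) {Q : F[X]} (hQ : Q.Monic) :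
    (∑ g ∈ monics F n, if Q ∣ g then lam χ ψ g else 0) =
      if Q.natDegree ≤ n then lam χ ψ Q * S χ ψ (n - Q.natDegree) else 0 := by
  rw [← Finset.sum_filter]
  split_ifs with h
  · rw [S, Finset.mul_sum]
    symm
    refine Finset.sum_bij (fun h _ => Q * h) ?_ ?_ ?_ ?_
    · intro g hg
      obtain ⟨h1, h2⟩ := mem_monics.mp hg
      rw [Finset.mem_filter, mem_monics]
      refine ⟨⟨hQ.mul h1, ?_⟩, dvd_mul_right _ _⟩
      rw [hQ.natDegree_mul h1]; omega
    · intro a _ b _ hab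
      exact mul_left_cancel₀ hQ.ne_zero hab
    · intro g hg
      rw [Finset.mem_filter, mem_monics] at hg
      obtain ⟨⟨h1, h2⟩, r, rfl⟩ := hg
      have hr : r.Monic := hQ.of_mul_monic_left h1
      refine ⟨r, mem_monics.mpr ⟨hr, ?_⟩, rfl⟩
      rw [hQ.natDegree_mul hr] at h2; omega
    · intro g hg
      rw [lam_mul χ ψ hQ (mem_monics.mp hg).1]
  · refine Finset.sum_eq_zero ?_
    intro g hg
    rw [Finset.mem_filter, mem_monics] at hg
    obtain ⟨⟨h1, h2⟩, h3⟩ := hg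
    exact absurd (h2 ▸ natDegree_le_of_dvd h3 h1.ne_zero) h

open Classical in
lemma degree_formula [Finite F] {N : ℕ} {g : F[X]} (hg : g.Monic) (hN : g.natDegree ≤ N) :
    g.natDegree = ∑ P ∈ irr F N, ∑ k ∈ Finset.Icc 1 N, if P ^ k ∣ g then P.natDegree else 0 := by
  have hprod : (normalizedFactors g).prod = g := by
    rw [prod_normalizedFactors_eq hg.ne_zero, hg.normalize_eq_self]
  have hmem : ∀ P ∈ normalizedFactors g, P.Monic ∧ Irreducible P ∧ P ∣ g := by
    intro P hP
    have hi := irreducible_of_normalized_factor P hP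
    refine ⟨?_, hi, dvd_of_mem_normalizedFactors hP⟩
    rw [← normalize_normalized_factor P hP]
    exact monic_normalize hi.ne_zero
  have h1 : g.natDegree =
      ∑ P ∈ (normalizedFactors g).toFinset, (normalizedFactors g).count P * P.natDegree := by
    conv_lhs => rw [← hprod]
    rw [natDegree_multiset_prod_of_monic _ (fun P hP => (hmem P hP).1),
      Finset.sum_multiset_map_count]
    simp
  have hsub : (normalizedFactors g).toFinset ⊆ irr F N := by
    intro P hP
    obtain ⟨a, b, c⟩ := hmem P (Multiset.mem_toFinset.mp hP)
    exact mem_irr.mpr ⟨a, b, (natDegree_le_of_dvd c hg.ne_zero).trans hN⟩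
  rw [h1, Finset.sum_subset hsub (fun P _ hP => by
    rw [Multiset.count_eq_zero_of_notMem (fun h => hP (Multiset.mem_toFinset.mpr h)), zero_mul])]
  refine Finset.sum_congr rfl fun P hP => ?_
  obtain ⟨a, b, c⟩ := mem_irr.mp hP
  have hdvd : ∀ k, P ^ k ∣ g ↔ k ≤ (normalizedFactors g).count P := by
    intro k
    rw [pow_dvd_iff_le_emultiplicity, emultiplicity_eq_count_normalizedFactors b hg.ne_zero,
      a.normalize_eq_self]
    exact_mod_cast Iff.rfl
  have hle : (normalizedFactors g).count P ≤ N := by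
    have := natDegree_le_of_dvd ((hdvd _).mpr le_rfl) hg.ne_zero
    rw [natDegree_pow] at this
    have h3 := b.natDegree_pos
    nlinarith
  simp only [hdvd]
  rw [← Finset.sum_filter, Finset.sum_const, smul_eq_mul]
  congr 1
  have : (Finset.Icc 1 N).filter (fun k => k ≤ (normalizedFactors g).count P) =
      Finset.Icc 1 ((normalizedFactors g).count P) := by
    ext k
    simp only [Finset.mem_filter, Finset.mem_Icc]
    omega
  rw [this]; simp

/-- Weighted sum over prime powers of degree `m`. -/
noncomputable def W [Finite F] (χ : MulChar F ℂ) (ψ : AddChar F ℂ) (N m : ℕ) : ℂ :=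
  ∑ P ∈ irr F N, ∑ k ∈ Finset.Icc 1 N,
    if k * P.natDegree = m then (P.natDegree : ℂ) * lam χ ψ P ^ k else 0

lemma newton [Finite F] (χ : MulChar F ℂ) (ψ : AddChar F ℂ) {N n : ℕ} (hn : n ≤ N) :
    (n : ℂ) * S χ ψ n = ∑ m ∈ Finset.Icc 1 n, W χ ψ N m * S χ ψ (n - m) := by
  classical
  have h1 : (n : ℂ) * S χ ψ n = ∑ P ∈ irr F N, ∑ k ∈ Finset.Icc 1 N,
      (P.natDegree : ℂ) * ∑ g ∈ monics F n, if P ^ k ∣ g then lam χ ψ g else 0 := by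
    rw [S, Finset.mul_sum]
    simp only [Finset.mul_sum]
    have : ∀ g ∈ monics F n, (n : ℂ) * lam χ ψ g = ∑ P ∈ irr F N, ∑ k ∈ Finset.Icc 1 N,
        (P.natDegree : ℂ) * (if P ^ k ∣ g then lam χ ψ g else 0) := by
      intro g hg
      obtain ⟨a, b⟩ := mem_monics.mp hg
      have := degree_formula a (b.trans_le hn)
      rw [b] at this
      rw [this]
      push_cast
      simp only [Finset.sum_mul]
      refine Finset.sum_congr rfl fun P _ => Finset.sum_congr rfl fun k _ => ?_
      split_ifs <;> simp
    rw [Finset.sum_congr rfl this, Finset.sum_comm]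
    refine Finset.sum_congr rfl fun P _ => ?_
    rw [Finset.sum_comm]
  rw [h1]
  simp only [W, Finset.sum_mul]
  conv_rhs => rw [Finset.sum_comm]
  refine Finset.sum_congr rfl fun P hP => ?_
  conv_rhs => rw [Finset.sum_comm]
  refine Finset.sum_congr rfl fun k hk => ?_
  obtain ⟨a, b, c⟩ := mem_irr.mp hP
  rw [sum_dvd χ ψ n (a.pow k), natDegree_pow, lam_pow χ ψ a]
  simp only [ite_mul, zero_mul]
  rw [Finset.sum_ite_eq]
  have hpos : 1 ≤ k * P.natDegree := Nat.mul_pos (Finset.mem_Icc.mp hk).1 b.natDegree_pos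
  simp only [Finset.mem_Icc, hpos, true_and]
  split_ifs
  · ring
  · simp

lemma W_eq [Finite F] (χ : MulChar F ℂ) (ψ : AddChar F ℂ) (hψ : ψ ≠ 1) {N : ℕ} (n : ℕ)
    (hn : n + 1 ≤ N) : W χ ψ N (n + 1) = (-1) ^ n * S χ ψ 1 ^ (n + 1) := by
  induction n with
  | zero =>
    have := newton χ ψ hn
    simp [S_zero] at this
    simp [this]
  | succ n ih =>
    have h := newton χ ψ hn
    rw [S_eq_zero χ ψ hψ (by omega), mul_zero, Finset.sum_Icc_succ_top (by omega),
      Finset.sum_Icc_succ_top (by omega), ih (by omega)] at h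
    rw [Finset.sum_eq_zero (fun m hm => by
      rw [S_eq_zero χ ψ hψ (by have := (Finset.mem_Icc.mp hm).2; omega), mul_zero])] at h
    rw [show n + 1 + 1 - (n + 1) = 1 by omega, Nat.sub_self, S_zero] at h
    linear_combination -h

variable {E : Type*} [Field E] [Algebra F E]

open IntermediateField in
lemma lam_minpoly [Finite E] (χ : MulChar F ℂ) (ψ : AddChar F ℂ) (x : E) :
    χ (Algebra.norm F x) * ψ (Algebra.trace F E x) =
      lam χ ψ (minpoly F x) ^ (Module.finrank F E / (minpoly F x).natDegree) := by
  have hx : IsIntegral F x := .of_finite F x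
  have hd : Module.finrank F E / (minpoly F x).natDegree = Module.finrank F⟮x⟯ E := by
    rw [← IntermediateField.adjoin.finrank hx, ← Module.finrank_mul_finrank F F⟮x⟯ E,
      Nat.mul_div_cancel_left _ Module.finrank_pos]
  have hnorm : Algebra.norm F (AdjoinSimple.gen F x) =
      (-1) ^ (minpoly F x).natDegree * (minpoly F x).coeff 0 := by
    have := Algebra.PowerBasis.norm_gen_eq_coeff_zero_minpoly (adjoin.powerBasis hx)
    simpa [minpoly_gen F x] using this
  rw [hd, Algebra.norm_eq_norm_adjoin F x, trace_eq_trace_adjoin F x, trace_adjoinSimpleGen hx,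
    hnorm, lam, map_pow, mul_pow, AddChar.map_nsmul_eq_pow]

lemma sum_E [Finite F] [Fintype E] (χ : MulChar F ℂ) (ψ : AddChar F ℂ) :
    ∑ x : E, χ (Algebra.norm F x) * ψ (Algebra.trace F E x) =
      W χ ψ (Module.finrank F E) (Module.finrank F E) := by
  classical
  set s := Module.finrank F E with hs
  have hs0 : 0 < s := Module.finrank_pos
  have hcard : Nat.card E = Nat.card F ^ s := Module.natCard_eq_pow_finrank
  have hmaps : ∀ x ∈ (Finset.univ : Finset E), minpoly F x ∈ irr F s := fun x _ =>
    mem_irr.mpr ⟨minpoly.monic (.of_finite F x), minpoly.irreducible (.of_finite F x),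
      minpoly.natDegree_le x⟩
  rw [← Finset.sum_fiberwise_of_maps_to hmaps, W]
  refine Finset.sum_congr rfl fun P hP => ?_
  obtain ⟨a, b, c⟩ := mem_irr.mp hP
  have hfib : ∀ x ∈ (Finset.univ : Finset E).filter (fun x => minpoly F x = P),
      χ (Algebra.norm F x) * ψ (Algebra.trace F E x) = lam χ ψ P ^ (s / P.natDegree) := by
    intro x hx
    rw [lam_minpoly, (Finset.mem_filter.mp hx).2]
  rw [Finset.sum_congr rfl hfib, Finset.sum_const, nsmul_eq_mul]
  by_cases hd : P.natDegree ∣ s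
  · have hdvd := b.natDegree_dvd_iff_dvd_X_pow_card_pow_sub_X.mp hd
    have hsplit : (P.map (algebraMap F E)).Splits := by
      have hE : (X ^ Nat.card E - X : E[X]).Splits := by
        rw [splits_iff_card_roots, Nat.card_eq_fintype_card, FiniteField.roots_X_pow_card_sub_X,
          FiniteField.X_pow_card_sub_X_natDegree_eq _ Fintype.one_lt_card]
        simp
      refine Splits.of_dvd hE ?_ ?_
      · exact FiniteField.X_pow_card_sub_X_ne_zero _ Finite.one_lt_card
      · have := Polynomial.map_dvd (algebraMap F E) hdvd
        rw [hcard]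
        simpa using this
    have hc : ((Finset.univ : Finset E).filter (fun x => minpoly F x = P)).card
        = P.natDegree := by
      rw [← card_rootSet_eq_natDegree (K := E) (PerfectField.separable_of_irreducible b) hsplit,
        ← Set.toFinset_card]
      congr 1
      ext x
      simp only [Finset.mem_filter, Finset.mem_univ, true_and, Set.mem_toFinset,
        mem_rootSet, b.ne_zero, ne_eq, not_false_eq_true]
      constructor
      · rintro rfl
        exact minpoly.aeval F x
      · intro h
        exact (minpoly.eq_of_irreducible_of_monic b h a).symm
    rw [hc, Finset.sum_eq_single (s / P.natDegree)]
    · rw [if_pos (Nat.div_mul_cancel hd)]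
    · intro k _ hk
      rw [if_neg]
      intro h
      exact hk (by rw [← h, Nat.mul_div_cancel _ b.natDegree_pos])
    · intro h
      exact absurd (Finset.mem_Icc.mpr ⟨Nat.div_pos c b.natDegree_pos, Nat.div_le_self _ _⟩) h
  · rw [Finset.filter_eq_empty_iff.mpr, Finset.card_empty, Nat.cast_zero, zero_mul]
    · symm
      refine Finset.sum_eq_zero fun k _ => if_neg fun h => hd ⟨k, by rw [← h, mul_comm]⟩
    · rintro x _ rfl
      exact hd (minpoly.degree_dvd (.of_finite F x))

lemma gaussSumC_eq (p : ℕ) [NeZero p] (K : Type*) [Field K] [Fintype K]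
    [Algebra (ZMod p) K] (χ : MulChar K ℂ) :
    gaussSumC p K χ = ∑ x : K, χ x * ZMod.stdAddChar (Algebra.trace (ZMod p) K x) := by
  unfold gaussSumC
  refine Finset.sum_congr rfl fun x _ => ?_
  have := ZMod.stdAddChar_coe (N := p) ((Algebra.trace (ZMod p) K x).val : ℤ)
  congr 1
  simpa using this.symm

end DH

/-- The Davenport–Hasse lifting formula: if `χ` is a nontrivial multiplicative character
of `𝔽_q` and `χ'` its lift to `𝔽_{q^s}` (via the norm), then
`G_{q^s}(χ') = (-1)^{s-1} (G_q(χ))^s`. -/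
theorem davenport_hasse_lifting
    (p f s : ℕ) (hp : p.Prime) (hs : 1 ≤ s)
    (F : Type*) [Field F] [Fintype F] [Algebra (ZMod p) F]
    (hF : Fintype.card F = p ^ f)
    (χ : MulChar F ℂ) (hχ : χ ≠ 1)
    (E : Type*) [Field E] [Fintype E] [Algebra (ZMod p) E] [Algebra F E]
    (hE : Fintype.card E = Fintype.card F ^ s)
    (χ' : MulChar E ℂ) (hχ' : ∀ x : E, χ' x = χ (Algebra.norm F x)) :
    gaussSumC p E χ' = (-1) ^ (s - 1) * gaussSumC p F χ ^ s := by
  have : Fact p.Prime := ⟨hp⟩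
  have hsF : Module.finrank F E = s :=
    Nat.pow_right_injective (Fintype.one_lt_card (α := F))
      ((Module.card_eq_pow_finrank (K := F) (V := E)).symm.trans hE)
  have : IsScalarTower (ZMod p) F E :=
    IsScalarTower.of_algebraMap_eq' (Subsingleton.elim _ _)
  let ψ : AddChar F ℂ :=
    (ZMod.stdAddChar (N := p)).compAddMonoidHom (Algebra.trace (ZMod p) F).toAddMonoidHom
  have hψa : ∀ x, ψ x = ZMod.stdAddChar (Algebra.trace (ZMod p) F x) := fun x => rfl
  have hψ : ψ ≠ 1 := by
    rw [AddChar.ne_one_iff]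
    obtain ⟨x, hx⟩ := Algebra.trace_surjective (ZMod p) F 1
    refine ⟨x, fun h => ?_⟩
    rw [hψa, hx, ← AddChar.map_zero_eq_one (ZMod.stdAddChar (N := p))] at h
    exact one_ne_zero (ZMod.injective_stdAddChar h)
  have h1 := DH.sum_E (E := E) χ ψ
  obtain ⟨n, rfl⟩ : ∃ n, s = n + 1 := ⟨s - 1, by omega⟩
  rw [hsF, DH.W_eq χ ψ hψ n le_rfl, DH.S_one] at h1
  rw [DH.gaussSumC_eq, DH.gaussSumC_eq, Nat.add_sub_cancel]
  simp only [hψa, Algebra.trace_trace] at h1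
  rw [← h1]
  simp only [hχ']
end

section
/- Let χ be a multiplicative character of F_q of order N > 1 and let f ∈ F_q[x] be a monic polynomial of positive degree that is not an N-th power of a polynomial over the algebraic closure. Let d be the number of distinct roots of f in its splitting field over F_q and suppose d ≥ 2. Then there exist complex numbers w1, …, w_{d−1}, depending only on f and χ, such that for every positive integer t, Σ_{x∈F_{q^t}} χ'(f(x)) = −w1^t − ⋯ − w_{d−1}^t, where χ' is the lift of χ to F_{q^t} (with χ'(0) = 0). In particular, |Σ_{x∈F_{q^t}} χ'(f(x))| ≤ (d−1) q^{t/2} for every positive integer t. -/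
section WeilAux

open Polynomial


open Finset in
lemma wm_newton (D : ℕ) (a S : ℕ → ℂ) (h0 : a 0 = 1) (hD : ∀ n, D < n → a n = 0)
    (hr : ∀ n : ℕ, 0 < n → (n : ℂ) * a n = ∑ p ∈ HasAntidiagonal.antidiagonal n with p.1 < n, a p.1 * S p.2) :
    ∃ w : Fin D → ℂ, ∀ t, 0 < t → S t = - ∑ j, w j ^ t := by
  classical
  let P : Polynomial ℂ := ∑ i ∈ range (D+1), Polynomial.C (a (D - i)) * Polynomial.X ^ i
  have hc : ∀ k, P.coeff k = if k ≤ D then a (D - k) else 0 := by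
    intro k
    simp [P, Polynomial.finsetSum_coeff, Polynomial.coeff_C_mul, Polynomial.coeff_X_pow]
  have hnd : P.natDegree = D := by
    apply le_antisymm
    · rw [Polynomial.natDegree_le_iff_coeff_eq_zero]
      intro k hk
      rw [hc, if_neg (by omega)]
    · apply Polynomial.le_natDegree_of_ne_zero
      rw [hc]; simp [h0]
  have hlc : P.leadingCoeff = 1 := by
    rw [Polynomial.leadingCoeff, hnd, hc]; simp [h0]
  have hs : P.Splits := IsAlgClosed.splits P
  have hcard : Multiset.card P.roots = D := by
    rw [← hnd]; exact Polynomial.splits_iff_card_roots.1 hs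
  obtain ⟨w, hw⟩ : ∃ w : Fin D → ℂ, (univ.val.map w) = P.roots := by
    obtain ⟨l, hl⟩ := Quot.exists_rep P.roots
    have hl' : (l : Multiset ℂ) = P.roots := hl
    have hlen : l.length = D := by rw [← hcard, ← hl']; simp
    subst hlen
    refine ⟨l.get, ?_⟩
    rw [← hl', Fin.univ_val_map]; simp
  refine ⟨w, ?_⟩
  have he : ∀ n, MvPolynomial.aeval w (MvPolynomial.esymm (Fin D) ℂ n) = (-1) ^ n * a n := by
    intro n
    rw [MvPolynomial.aeval_esymm_eq_multiset_esymm, hw]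
    by_cases hn : n ≤ D
    · have := Polynomial.coeff_eq_esymm_roots_of_splits hs (k := D - n) (by omega)
      rw [hc, if_pos (by omega), hlc, hnd, Nat.sub_sub_self hn] at this
      rw [this, one_mul, ← mul_assoc, ← pow_add, ← two_mul, pow_mul]; simp
    · rw [hD n (by omega), mul_zero, Multiset.esymm, Multiset.powersetCard_eq_empty]
      · simp
      · omega
  have hp : ∀ n, MvPolynomial.aeval w (MvPolynomial.psum (Fin D) ℂ n) = ∑ j, w j ^ n := by
    intro n; simp [MvPolynomial.psum]
  have hN : ∀ n : ℕ, (n : ℂ) * a n = ∑ p ∈ HasAntidiagonal.antidiagonal n with p.1 < n, a p.1 * (-∑ j, w j ^ p.2) := by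
    intro n
    have := congrArg (MvPolynomial.aeval w) (MvPolynomial.mul_esymm_eq_sum (Fin D) ℂ n)
    simp only [map_mul, map_sum, map_pow, map_neg, map_one, map_natCast, he, hp] at this
    have h2 : ((-1 : ℂ)^n) * (-1)^n = 1 := by rw [← pow_add, ← two_mul, pow_mul]; simp
    calc (n:ℂ) * a n = (-1)^n * (n * ((-1)^n * a n)) := by linear_combination (-(n:ℂ) * a n) * h2
      _ = _ := by
        rw [this, ← mul_assoc, pow_succ, ← mul_assoc, h2, one_mul, neg_one_mul, ← sum_neg_distrib]
        apply sum_congr rfl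
        intro p hp
        have h3 : ((-1 : ℂ)^p.1) * (-1)^p.1 = 1 := by rw [← pow_add, ← two_mul, pow_mul]; simp
        linear_combination (-(a p.1) * ∑ j, w j ^ p.2) * h3
  intro t
  induction t using Nat.strong_induction_on with
  | _ t ih =>
    intro ht
    have h1 := (hr t ht).symm.trans (hN t)
    have hmem : ((0, t) : ℕ × ℕ) ∈ (HasAntidiagonal.antidiagonal t).filter (fun p => p.1 < t) := by simp [ht]
    rw [← add_sum_erase _ _ hmem, ← add_sum_erase _ _ hmem] at h1
    have h2 : ∑ x ∈ ((HasAntidiagonal.antidiagonal t).filter (fun p => p.1 < t)).erase (0, t), a x.1 * S x.2 =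
      ∑ x ∈ ((HasAntidiagonal.antidiagonal t).filter (fun p => p.1 < t)).erase (0, t), a x.1 * -∑ j, w j ^ x.2 := by
      apply sum_congr rfl
      rintro ⟨i, j⟩ hx
      simp only [mem_erase, mem_filter, HasAntidiagonal.mem_antidiagonal, ne_eq, Prod.mk.injEq] at hx
      rw [ih j (by omega) (by omega)]
    rw [h2] at h1
    simpa [h0] using h1

open Filter Topology in
lemma wm_bound (D : ℕ) (z : Fin D → ℂ) (C : ℝ) (n0 : ℕ)
    (h : ∀ n, n0 ≤ n → ‖∑ j, z j ^ n‖ ≤ C) : ∀ j, ‖z j‖ ≤ 1 := by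
  classical
  by_contra! hcon
  obtain ⟨j0, hj0⟩ := hcon
  have hu : ∃ u : Fin D → Circle, ∀ j, z j = ‖z j‖ * (u j : ℂ) := by
    refine ⟨fun j => Circle.exp (Complex.arg (z j)), fun j => ?_⟩
    rw [Circle.coe_exp]; exact (Complex.norm_mul_exp_arg_mul_I (z j)).symm
  obtain ⟨u, hu⟩ := hu
  have hcl := mapClusterPt_one_atTop_pow u
  let s : Set (Fin D → Circle) := {v | ∀ j, 1/2 < ((v j : ℂ)).re}
  have hs : s ∈ 𝓝 (1 : Fin D → Circle) := by
    apply IsOpen.mem_nhds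
    · have : s = ⋂ j, {v : Fin D → Circle | 1/2 < ((v j : ℂ)).re} := by ext; simp [s]
      rw [this]
      apply isOpen_iInter_of_finite
      intro j
      apply isOpen_lt continuous_const
      exact Complex.continuous_re.comp (continuous_subtype_val.comp (continuous_apply j))
    · intro j; simp; norm_num
  have hfr := hcl.frequently hs
  have htend : Tendsto (fun n : ℕ => (1/2) * ‖z j0‖ ^ n) atTop atTop :=
    (tendsto_pow_atTop_atTop_of_one_lt hj0).const_mul_atTop (by norm_num)
  obtain ⟨n, hn1, hn2, hn3⟩ := (hfr.and_eventually
    ((htend.eventually_gt_atTop C).and (eventually_ge_atTop n0))).exists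
  have h1 := h n hn3
  have h2 : (∑ j, z j ^ n).re ≤ C := (Complex.re_le_norm _).trans h1
  have h3 : ∀ j, (z j ^ n).re = ‖z j‖ ^ n * ((u j : ℂ)^n).re := by
    intro j
    conv_lhs => rw [hu j, mul_pow, ← Complex.ofReal_pow, Complex.re_ofReal_mul]
  have h4 : ∀ j, 1/2 < ((u j : ℂ)^n).re := by
    intro j; have := hn1 j; simpa using this
  rw [Complex.re_sum] at h2
  have h5 : (z j0 ^ n).re ≤ ∑ j, (z j ^ n).re := by
    apply Finset.single_le_sum (f := fun j => (z j ^ n).re) _ (Finset.mem_univ j0)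
    intro j _
    simp only [h3]
    have := h4 j
    positivity
  rw [h3] at h5
  have h6 : 0 < ‖z j0‖ ^ n := by positivity
  nlinarith [h4 j0]


lemma wm_natDegree_resultant {S : Type*} [CommRing S] (A H : (S[X])[X]) (m n a b : ℕ)
    (hA : ∀ i, (A.coeff i).natDegree ≤ a) (hH : ∀ i, (H.coeff i).natDegree ≤ b) :
    (resultant A H m n).natDegree ≤ m * b + n * a := by
  unfold resultant
  rw [Matrix.det_apply]
  apply natDegree_sum_le_of_forall_le
  intro σ _
  refine (natDegree_smul_le _ _).trans ?_
  rw [Fin.prod_univ_add]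
  refine natDegree_mul_le.trans ?_
  apply add_le_add
  · refine (natDegree_prod_le _ _).trans ?_
    refine (Finset.sum_le_card_nsmul _ _ b ?_).trans (by simp)
    intro i _
    simp only [sylvester, Matrix.of_apply, Fin.addCases_left]
    split_ifs
    · exact hH _
    · simp
  · refine (natDegree_prod_le _ _).trans ?_
    refine (Finset.sum_le_card_nsmul _ _ a ?_).trans (by simp)
    intro i _
    simp only [sylvester, Matrix.of_apply, Fin.addCases_right]
    split_ifs
    · exact hA _
    · simp

/-- the specialisation `Z ↦ X^Q`. -/
noncomputable def wmSpec (F : Type*) [Field F] (Q : ℕ) : (F[X])[X] →+* F[X] :=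
  eval₂RingHom (expand F Q : F[X] →+* F[X]) X

lemma wm_spec_inj {F : Type*} [Field F] (Q : ℕ) (P : (F[X])[X])
    (hP : P.natDegree < Q) (h0 : wmSpec F Q P = 0) : P = 0 := by
  have hQ : 0 < Q := by omega
  ext l k
  rw [coeff_zero, coeff_zero]
  by_cases hl : l < Q
  swap
  · rw [coeff_eq_zero_of_natDegree_lt (p := P) (by omega), coeff_zero]
  have h1 : wmSpec F Q P = ∑ i ∈ Finset.range Q, expand F Q (P.coeff i) * X ^ i := by
    simp only [wmSpec, coe_eval₂RingHom]
    rw [eval₂_eq_sum_range' _ hP]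
    rfl
  have h2 := congrArg (fun p => coeff p (Q * k + l)) (h1.symm.trans h0)
  simp only [finsetSum_coeff, coeff_zero] at h2
  rw [Finset.sum_eq_single l] at h2
  · rw [coeff_mul_X_pow, mul_comm Q k, coeff_expand_mul hQ] at h2
    exact h2
  · intro i hi hil
    rw [Finset.mem_range] at hi
    rw [coeff_mul_X_pow']
    split_ifs with hle
    · rw [coeff_expand hQ, if_neg]
      rintro ⟨c, hc⟩
      apply hil
      have h3 : Q * k + l = Q * c + i := by omega
      have h4 := congrArg (· % Q) h3
      simp only [Nat.mul_add_mod, Nat.mod_eq_of_lt hi, Nat.mod_eq_of_lt hl] at h4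
      exact h4.symm
    · rfl
  · intro h; simp [hl] at h

lemma wm_irred {F : Type*} [Field F] (N : ℕ) (hN : 0 < N) (f : F[X]) (hf : f.Monic)
    (hg : ∀ c : ℕ, (∀ P : F[X], Irreducible P → N ∣ c * multiplicity P f) → N ∣ c) :
    Irreducible (X ^ N - C (algebraMap (F[X])[X] (FractionRing (F[X])[X]) (C f) /
      algebraMap (F[X])[X] (FractionRing (F[X])[X]) (f.map C))) := by
  set K := FractionRing (F[X])[X] with hK
  set ι := algebraMap (F[X])[X] K with hι
  have hinj : Function.Injective ι := IsFractionRing.injective _ _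
  have hfX : (f.map C : (F[X])[X]).Monic := hf.map _
  have hfX0 : ι (f.map C) ≠ 0 := by
    rw [Ne, map_eq_zero_iff _ hinj]; exact hfX.ne_zero
  set c := ι (C f) / ι (f.map C) with hc
  have hmon : (X ^ N - C c : K[X]).Monic := monic_X_pow_sub_C _ (by omega)
  have hdeg : (X ^ N - C c : K[X]).natDegree = N := natDegree_X_pow_sub_C
  rw [hmon.irreducible_iff_natDegree]
  refine ⟨fun h => by rw [h] at hdeg; simp at hdeg; omega, ?_⟩
  intro A B hA hB hAB
  set k := A.natDegree with hk
  suffices hNk : N ∣ k by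
    have hsum : A.natDegree + B.natDegree = N := by
      rw [← hdeg, ← hAB, hA.natDegree_mul hB]
    rcases Nat.eq_zero_or_pos k with h | h
    · left; exact h
    · right; have := Nat.le_of_dvd h hNk; omega
  -- constant coefficient
  have ha0 : (A.coeff 0) ^ N = (-1) ^ (k * N) * c ^ k := by
    let L := AlgebraicClosure K
    apply (algebraMap K L).injective
    have hs : (A.map (algebraMap K L)).Splits := IsAlgClosed.splits _
    have h1 := hs.coeff_zero_eq_prod_roots_of_monic (hA.map _)
    rw [coeff_map, hA.natDegree_map] at h1
    have h2 : ((A.map (algebraMap K L)).roots.map (fun x => x ^ N)).prod = (algebraMap K L c) ^ k := by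
      rw [Multiset.map_congr rfl (g := fun _ => algebraMap K L c)]
      · rw [Multiset.map_const', Multiset.prod_replicate, splits_iff_card_roots.1 hs, hA.natDegree_map]
      · intro x hx
        have hx' := (mem_roots'.1 hx).2
        have h3 : (X ^ N - C c : K[X]).aeval x = 0 := by
          rw [← hAB, map_mul]
          have : A.aeval x = 0 := by
            rw [IsRoot.def, eval_map_algebraMap] at hx'
            exact hx'
          rw [this, zero_mul]
        simpa [sub_eq_zero] using h3
    rw [Multiset.prod_map_pow, Multiset.map_id'] at h2
    rw [map_pow, h1, mul_pow, h2, map_mul, ← pow_mul, hk]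
    simp
  have hkey : (A.coeff 0 * ι (f.map C) ^ k) ^ N =
      ι ((-1) ^ (k * N) * (C f ^ k * (f.map C) ^ (k * (N - 1)))) := by
    rw [mul_pow, ha0]
    simp only [map_mul, map_pow, map_neg, map_one]
    have hcz : c * ι (f.map C) = ι (C f) := div_mul_cancel₀ _ hfX0
    rw [← hcz, mul_pow, ← pow_mul]
    have hNN : k * N = k + k * (N - 1) := by
      obtain ⟨M, rfl⟩ : ∃ M, N = M + 1 := ⟨N - 1, by omega⟩
      rw [Nat.add_sub_cancel]; ring
    rw [hNN, pow_add (ι (f.map C)) k]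
    ring
  obtain ⟨β, hβ⟩ : ∃ β : (F[X])[X], ι β = A.coeff 0 * ι (f.map C) ^ k := by
    apply IsIntegrallyClosed.exists_algebraMap_eq_of_isIntegral_pow hN
    rw [hkey]
    exact isIntegral_algebraMap
  have hβN : β ^ N = (-1) ^ (k * N) * (C f ^ k * (f.map C) ^ (k * (N - 1))) := by
    apply hinj
    rw [map_pow, hβ, hkey]
  apply hg
  intro P hP
  have hCP : Prime (C P : (F[X])[X]) := prime_C_iff.2 hP.prime
  have hm1 : emultiplicity (C P) (f.map C : (F[X])[X]) = 0 := by
    rw [emultiplicity_eq_zero, C_dvd_iff_dvd_coeff]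
    intro h
    have := h (f.map C : (F[X])[X]).natDegree
    rw [coeff_natDegree, hfX.leadingCoeff] at this
    exact hP.not_isUnit (isUnit_of_dvd_one this)
  have hm2 : emultiplicity (C P) (C f : (F[X])[X]) = emultiplicity P f := by
    rw [emultiplicity_eq_emultiplicity_iff]
    intro n
    rw [← C_pow, C_dvd_iff_dvd_coeff]
    constructor
    · intro h; simpa using h 0
    · intro h i
      rw [coeff_C]; split_ifs
      · exact h
      · exact dvd_zero _
  have hfin : FiniteMultiplicity P f := FiniteMultiplicity.of_prime_left hP.prime hf.ne_zero
  have hm3 := congrArg (emultiplicity (C P)) hβN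
  rw [emultiplicity_pow hCP, emultiplicity_mul hCP, emultiplicity_mul hCP, emultiplicity_pow hCP,
    emultiplicity_pow hCP, emultiplicity_pow hCP, hm1, hm2,
    emultiplicity_of_isUnit_right hCP.not_isUnit (isUnit_one.neg)] at hm3
  simp only [mul_zero, zero_add, add_zero] at hm3
  rw [hfin.emultiplicity_eq_multiplicity] at hm3
  have hβ0 : β ≠ 0 := by
    rintro rfl
    rw [zero_pow (by omega)] at hβN
    have : (-1) ^ (k * N) * (C f ^ k * (f.map C) ^ (k * (N - 1))) ≠ (0 : (F[X])[X]) := by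
      apply mul_ne_zero (pow_ne_zero _ (by simp))
      exact mul_ne_zero (pow_ne_zero _ (by simpa using hf.ne_zero)) (pow_ne_zero _ hfX.ne_zero)
    exact this hβN.symm
  rw [(FiniteMultiplicity.of_prime_left hCP hβ0).emultiplicity_eq_multiplicity] at hm3
  refine ⟨multiplicity (C P) β, ?_⟩
  exact_mod_cast hm3.symm

lemma wm_nonvanish {F : Type*} [Field F] (N : ℕ) (hN : 0 < N) (f : F[X]) (hf : f.Monic)
    (hg : ∀ c : ℕ, (∀ P : F[X], Irreducible P → N ∣ c * multiplicity P f) → N ∣ c)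
    (Q D : ℕ) (g : F[X]) (hgf : g ^ N * f = expand F Q f)
    (H : ((F[X])[X])[X]) (hH0 : H ≠ 0) (hHN : H.natDegree < N)
    (hHD : ∀ i, (H.coeff i).natDegree ≤ D) (hQ : N * (D + f.natDegree) < Q) :
    eval₂ (wmSpec F Q) g H ≠ 0 := by
  intro h0
  set A : ((F[X])[X])[X] := C (f.map C) * X ^ N - C (C f) with hA
  have hAdeg : A.natDegree ≤ N := by
    rw [hA]; compute_degree
  have hA0 : eval₂ (wmSpec F Q) g A = 0 := by
    have h1 : wmSpec F Q (f.map C) = f := by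
      simp only [wmSpec, coe_eval₂RingHom, eval₂_map]
      have : (((expand F Q : F[X] →ₐ[F] F[X]) : F[X] →+* F[X]).comp C) = C := by
        ext; simp
      rw [this, eval₂_C_X]
    have h2 : wmSpec F Q (C f) = expand F Q f := by
      simp [wmSpec]
    simp only [hA, eval₂_sub, eval₂_mul, eval₂_C, eval₂_pow, eval₂_X, h1, h2, ← hgf]
    ring
  obtain ⟨p, q, -, -, hpq⟩ := exists_mul_add_mul_eq_C_resultant (m := N) (n := H.natDegree)
    A H hAdeg le_rfl (Or.inl hN.ne')
  have h1 := congrArg (eval₂ (wmSpec F Q) g) hpq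
  rw [eval₂_add, eval₂_mul, eval₂_mul, hA0, h0, eval₂_C, zero_mul, zero_mul, zero_add] at h1
  have hAc : ∀ i, (A.coeff i).natDegree ≤ f.natDegree := by
    intro i
    rw [hA, coeff_sub, coeff_C_mul, coeff_X_pow, coeff_C]
    refine (natDegree_sub_le _ _).trans (max_le ?_ ?_)
    · split_ifs <;> simp
    · split_ifs <;> simp
  have h2 : A.resultant H N H.natDegree = 0 := by
    apply wm_spec_inj Q _ _ h1.symm
    refine (wm_natDegree_resultant A H _ _ _ _ hAc hHD).trans_lt ?_
    have : H.natDegree * f.natDegree ≤ N * f.natDegree := Nat.mul_le_mul_right _ hHN.le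
    rw [mul_add] at hQ
    omega
  set K := FractionRing (F[X])[X] with hK
  set ι := algebraMap (F[X])[X] K with hι
  have hinj : Function.Injective ι := IsFractionRing.injective _ _
  have hfX : (f.map C : (F[X])[X]).Monic := hf.map _
  have hfX0 : ι (f.map C) ≠ 0 := by
    rw [Ne, map_eq_zero_iff _ hinj]; exact hfX.ne_zero
  have hirr := wm_irred N hN f hf hg
  set c := ι (C f) / ι (f.map C) with hc
  have hAm : A.map ι = C (ι (f.map C)) * (X ^ N - C c) := by
    simp only [hA, Polynomial.map_sub, Polynomial.map_mul, map_C, Polynomial.map_pow, map_X, mul_sub]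
    rw [← C_mul, hc, mul_div_cancel₀ _ hfX0]
  have hAmdeg : (A.map ι).natDegree = N := by
    rw [hAm, natDegree_C_mul hfX0, natDegree_X_pow_sub_C]
  have h3 : (A.map ι).resultant (H.map ι) = 0 := by
    rw [hAmdeg, natDegree_map_eq_of_injective hinj, resultant_map_map, h2, map_zero]
  rw [resultant_eq_zero_iff] at h3
  apply h3.2
  rw [hAm, isCoprime_mul_unit_left_left (isUnit_C.2 hfX0.isUnit), hirr.coprime_iff_not_dvd]
  intro hdvd
  have h4 := natDegree_le_of_dvd hdvd ((Polynomial.map_ne_zero_iff hinj).2 hH0)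
  rw [natDegree_X_pow_sub_C, natDegree_map_eq_of_injective hinj] at h4
  omega

lemma wm_expand_pow {F : Type*} [Field F] [Fintype F] (u : ℕ) (f : F[X]) :
    expand F (Fintype.card F ^ u) f = f ^ (Fintype.card F ^ u) := by
  induction u with
  | zero => simp
  | succ u ih => rw [pow_succ, expand_mul, FiniteField.expand_card, map_pow, ih, ← pow_mul]

lemma wm_stepanov_aux {F : Type*} [Field F] [Fintype F] (N : ℕ) (hN : 0 < N) (f : F[X]) (hf : f.Monic)
    (hg : ∀ c : ℕ, (∀ P : F[X], Irreducible P → N ∣ c * multiplicity P f) → N ∣ c)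
    (u Q r D K : ℕ) (hQ : Q = Fintype.card F ^ u) (hr : Q = N * r + 1)
    (h1 : N * (D + f.natDegree) < Q)
    (h2 : Q * D + K + f.natDegree * Q < N * K * (D + 1))
    (E : Type*) [Field E] [Fintype E] [DecidableEq E] [Algebra F E] (hE : Fintype.card E = Q ^ 2)
    (a : F) (ha : a ≠ 0) :
    (Finset.univ.filter (fun x : E => (aeval x f) ^ ((Q + 1) * r) = algebraMap F E a)).card
      ≤ D + Q * K + f.natDegree * Q := by
  classical
  set m := f.natDegree with hm
  set n := Q * D + K + m * Q with hn
  have hNr : (N - 1) * r ≤ Q := by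
    rw [Nat.sub_mul]; omega
  let I := Fin N × Fin K × Fin (D + 1)
  let b : I → F[X] := fun i => X ^ (Q * i.2.2 + i.2.1 : ℕ) * (C (a ^ (i.1 : ℕ)) * f ^ ((N - 1 - i.1) * r))
  let T : (I → F) →ₗ[F] (Fin n → F) :=
    LinearMap.pi (fun i : Fin n => (lcoeff F (i : ℕ)) ∘ₗ (Fintype.linearCombination F b))
  have hker : LinearMap.ker T ≠ ⊥ := by
    apply LinearMap.ker_ne_bot_of_finrank_lt
    simp only [Module.finrank_fintype_fun_eq_card, Fintype.card_fin, I, Fintype.card_prod]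
    calc n < N * K * (D + 1) := h2
      _ = _ := by ring
  obtain ⟨v, hvT, hv0⟩ := Submodule.exists_mem_ne_zero_of_ne_bot hker
  have hb : ∀ i : I, (b i).natDegree < n := by
    intro i
    have hfd : (f ^ ((N - 1 - (i.1 : ℕ)) * r)).natDegree ≤ m * Q := by
      refine natDegree_pow_le.trans ?_
      rw [mul_comm]
      apply Nat.mul_le_mul_left
      refine le_trans ?_ hNr
      apply Nat.mul_le_mul_right; omega
    have hCd : (C (a ^ (i.1 : ℕ)) * f ^ ((N - 1 - (i.1 : ℕ)) * r)).natDegree ≤ m * Q :=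
      (natDegree_C_mul_le _ _).trans hfd
    refine natDegree_mul_le.trans_lt ?_
    rw [natDegree_X_pow]
    have hi1 : Q * (i.2.2 : ℕ) ≤ Q * D := Nat.mul_le_mul_left _ (by have := i.2.2.2; omega)
    have hi2 := i.2.1.2
    omega
  have hsum0 : ∑ i, v i • b i = 0 := by
    ext l
    rw [coeff_zero]
    by_cases hl : l < n
    · have := congrFun (LinearMap.mem_ker.1 hvT) ⟨l, hl⟩
      simpa [T, Fintype.linearCombination_apply] using this
    · rw [finsetSum_coeff]
      apply Finset.sum_eq_zero
      intro i _
      rw [coeff_smul, coeff_eq_zero_of_natDegree_lt (by have := hb i; omega), smul_zero]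
  -- the auxiliary polynomial
  let H : ((F[X])[X])[X] := ∑ i : I, monomial (i.1 : ℕ) (monomial (i.2.2 : ℕ) (monomial (i.2.1 : ℕ) (v i)))
  have hHc : ∀ i : I, (((H.coeff i.1).coeff i.2.2).coeff i.2.1) = v i := by
    intro i
    simp only [H, finsetSum_coeff]
    rw [Finset.sum_eq_single i]
    · simp
    · intro j _ hj
      simp only [coeff_monomial]
      by_cases e1 : (j.1 : ℕ) = i.1
      · by_cases e2 : (j.2.2 : ℕ) = i.2.2
        · by_cases e3 : (j.2.1 : ℕ) = i.2.1
          · exfalso; apply hj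
            ext <;> assumption
          · simp [e1, e2, e3, coeff_monomial]
        · simp [e1, e2, coeff_monomial]
      · simp [e1]
    · simp
  have hH0 : H ≠ 0 := by
    intro h
    apply hv0
    ext i
    rw [← hHc i, h]; simp
  have hHN : H.natDegree < N := by
    rw [Nat.lt_iff_le_pred hN]
    apply natDegree_sum_le_of_forall_le
    intro i _
    refine (natDegree_monomial_le _).trans ?_
    have := i.1.2
    omega
  have hHD : ∀ l, (H.coeff l).natDegree ≤ D := by
    intro l
    simp only [H, finsetSum_coeff]
    apply natDegree_sum_le_of_forall_le
    intro i _
    rw [coeff_monomial]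
    split_ifs
    · refine (natDegree_monomial_le _).trans ?_
      have := i.2.2.2
      omega
    · simp
  have hgf : (f ^ r) ^ N * f = expand F Q f := by
    rw [hQ, wm_expand_pow, ← hQ, hr, ← pow_mul, pow_succ, mul_comm r N]
  have hP0 := wm_nonvanish N hN f hf hg Q D (f ^ r) hgf H hH0 hHN hHD h1
  set P : F[X] := ∑ i : I, C (v i) * (X ^ (i.2.2 : ℕ) * X ^ (Q * (i.2.1 : ℕ)) * f ^ (r * (i.1 : ℕ))) with hP
  have hPH : eval₂ (wmSpec F Q) (f ^ r) H = P := by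
    simp only [H, hP, eval₂_finsetSum, eval₂_monomial]
    apply Finset.sum_congr rfl
    intro i _
    simp only [wmSpec, coe_eval₂RingHom, eval₂_monomial, RingHom.coe_coe, expand_monomial]
    rw [← C_mul_X_pow_eq_monomial]
    ring
  rw [hPH] at hP0
  have hPdeg : P.natDegree ≤ D + Q * K + m * Q := by
    rw [hP]
    apply natDegree_sum_le_of_forall_le
    intro i _
    refine (natDegree_C_mul_le _ _).trans ?_
    refine natDegree_mul_le.trans ?_
    rw [← pow_add, natDegree_X_pow]
    have hfd : (f ^ (r * (i.1 : ℕ))).natDegree ≤ m * Q := by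
      refine natDegree_pow_le.trans ?_
      rw [mul_comm, ← hm]
      apply Nat.mul_le_mul_left
      rw [mul_comm]
      refine le_trans ?_ hNr
      apply Nat.mul_le_mul_right; have := i.1.2; omega
    have hi1 : Q * (i.2.1 : ℕ) ≤ Q * K := Nat.mul_le_mul_left _ (by have := i.2.1.2; omega)
    have hi2 := i.2.2.2
    omega
  refine le_trans ?_ hPdeg
  have hmap : P.map (algebraMap F E) ≠ 0 := (Polynomial.map_ne_zero_iff (algebraMap F E).injective).2 hP0
  rw [← natDegree_map (algebraMap F E)]
  apply card_le_degree_of_subset_roots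
  intro x hx
  have hx' : (aeval x f) ^ ((Q + 1) * r) = algebraMap F E a := by simpa using hx
  rw [mem_roots hmap, IsRoot.def, eval_map_algebraMap]
  -- evaluate
  have hfx : aeval x f ≠ 0 := by
    intro h
    rw [h] at hx'
    rcases Nat.eq_zero_or_pos ((Q + 1) * r) with h0 | h0
    · have hr0 : r = 0 := by
        rcases Nat.mul_eq_zero.1 h0 with h | h
        · omega
        · exact h
      subst hr0
      have hDm : N * (D + m) = 0 := by omega
      have hDm' : D + m = 0 := by
        rcases Nat.mul_eq_zero.1 hDm with h | h
        · omega
        · exact h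
      have hm0 : f = 1 := by
        apply Polynomial.eq_one_of_monic_natDegree_zero hf; omega
      rw [hm0] at h; simp at h
    · rw [zero_pow (by omega)] at hx'
      exact ha ((map_eq_zero _).1 hx'.symm)
  have hxQ : x ^ (Q * Q) = x := by
    rw [← sq, ← hE]; exact FiniteField.pow_card x
  have hfrob : ∀ p : F[X], (aeval x p) ^ Q = aeval x (expand F Q p) := by
    intro p; rw [hQ, wm_expand_pow, map_pow]
  have hzero : (aeval x P) ^ Q * (aeval x f) ^ ((N - 1) * r) = aeval x (∑ i, v i • b i) := by
    rw [hfrob, hP]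
    simp only [map_sum, map_mul, map_pow, expand_C, expand_X, Finset.sum_mul, b, smul_eq_C_mul]
    apply Finset.sum_congr rfl
    intro i _
    rw [hQ, wm_expand_pow, ← hQ]
    simp only [map_mul, map_pow, aeval_C, aeval_X, ← hx']
    have e1 : (x ^ Q) ^ (Q * (i.2.1 : ℕ)) = x ^ (i.2.1 : ℕ) := by
      rw [← pow_mul, ← mul_assoc, pow_mul, hxQ]
    rw [e1]
    have e2 : (N - 1) * r = (i.1 : ℕ) * r + (N - 1 - i.1) * r := by
      rw [← add_mul]; congr 1; have := i.1.2; omega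
    rw [e2]
    ring
  rw [hsum0, map_zero] at hzero
  rcases mul_eq_zero.1 hzero with h | h
  · exact pow_eq_zero_iff (by omega) |>.1 h
  · exact absurd h (pow_ne_zero _ hfx)

lemma wm_stepanov {F : Type*} [Field F] [Fintype F] (N : ℕ) (hN : 2 ≤ N) (f : F[X]) (hf : f.Monic)
    (hg : ∀ c : ℕ, (∀ P : F[X], Irreducible P → N ∣ c * multiplicity P f) → N ∣ c)
    (u Q r : ℕ) (hQ : Q = Fintype.card F ^ u) (hr : Q = N * r + 1)
    (hbig : N * (f.natDegree + 2) ^ 2 + 10 ≤ Q)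
    (E : Type*) [Field E] [Fintype E] [DecidableEq E] [Algebra F E] (hE : Fintype.card E = Q ^ 2)
    (a : F) (ha : a ≠ 0) :
    (Finset.univ.filter (fun x : E => (aeval x f) ^ ((Q + 1) * r) = algebraMap F E a)).card
      ≤ Q * r + Q * (2 * f.natDegree + 3) := by
  set m := f.natDegree with hm
  have hrm : m ≤ r := by
    by_contra h
    push Not at h
    have : N * r ≤ N * (m+2)^2 := Nat.mul_le_mul_left _ (by nlinarith)
    omega
  obtain ⟨D, hD⟩ := Nat.exists_eq_add_of_le hrm
  have h := wm_stepanov_aux N (by omega) f hf hg u Q r D (r + m + 2) hQ hr ?_ ?_ E hE a ha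
  · refine h.trans ?_
    rw [← hm]
    have : D ≤ Q := by nlinarith
    nlinarith
  · rw [← hm, add_comm D m, ← hD]; omega
  · rw [← hm]
    have hQ2 : (Q : ℤ) = N * r + 1 := by exact_mod_cast hr
    have hr2 : (r : ℤ) = m + D := by exact_mod_cast hD
    have hb2 : (N : ℤ) * (m + 2) ^ 2 + 10 ≤ Q := by exact_mod_cast hbig
    have hN2 : (2 : ℤ) ≤ N := by exact_mod_cast hN
    have hm0 : (0 : ℤ) ≤ m := by positivity
    have hD0 : (0 : ℤ) ≤ D := by positivity
    zify
    have hD' : (D : ℤ) = r - m := by linarith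
    have e : (N : ℤ) * (r + m + 2) * (D + 1) = (Q - 1) * (D + 1) + (m + 2) * ((Q - 1) - N * m + N) := by
      rw [hD']; rw [hQ2]; ring
    rw [e]
    have hrQ : 2 * (r : ℤ) ≤ Q := by nlinarith
    nlinarith [mul_nonneg hm0 (by linarith : (0 : ℤ) ≤ N)]

lemma wm_mem_range {F E : Type*} [Field F] [Fintype F] [Field E] [Algebra F E] (a : E)
    (ha : a ^ Fintype.card F = a) : ∃ c : F, algebraMap F E c = a := by
  classical
  have h1 : (Finset.univ.image (algebraMap F E)).card = Fintype.card F := by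
    rw [Finset.card_image_of_injective _ (algebraMap F E).injective, Finset.card_univ]
  have hq : 1 < Fintype.card F := Fintype.one_lt_card
  have h0 : (X ^ Fintype.card F - X : E[X]) ≠ 0 := FiniteField.X_pow_card_sub_X_ne_zero E hq
  by_contra hcon
  push Not at hcon
  have hnot : a ∉ Finset.univ.image (algebraMap F E) := by simpa using hcon
  have h2 := card_le_degree_of_subset_roots (p := (X ^ Fintype.card F - X : E[X]))
    (Z := insert a (Finset.univ.image (algebraMap F E))) (by
      intro x hx
      rw [mem_roots h0]
      simp only [Finset.insert_val, Multiset.mem_ndinsert, Finset.mem_val, Finset.mem_image, Finset.mem_univ, true_and] at hx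
      rcases hx with rfl | ⟨c, rfl⟩
      · simp [ha]
      · simp [← map_pow, FiniteField.pow_card])
  rw [Finset.card_insert_of_notMem hnot, h1, FiniteField.X_pow_card_sub_X_natDegree_eq E hq] at h2
  omega

lemma wm_sum_bound {E : Type*} [Field E] [Fintype E] [DecidableEq E] (ψ : MulChar E ℂ) (N M B : ℕ)
    (hM : Fintype.card E - 1 = N * M) (hψN : ψ ^ N = 1) (hψ : ψ ≠ 1) (φ : E → E)
    (hB : ∀ a : E, a ^ N = 1 → (Finset.univ.filter (fun x => φ x ^ M = a)).card ≤ B) :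
    ‖∑ x, ψ (φ x)‖ ≤ (N * B : ℝ) - Fintype.card E + (Finset.univ.filter (fun x => φ x = 0)).card := by
  obtain ⟨G, hG⟩ := IsCyclic.exists_generator (α := Eˣ)
  have hcard : 1 < Fintype.card E := Fintype.one_lt_card
  have hNM : 0 < N * M := by omega
  have hN : 0 < N := Nat.pos_of_mul_pos_right hNM
  have hMpos : 0 < M := Nat.pos_of_mul_pos_left hNM
  have hord : orderOf G = N * M := by
    rw [orderOf_eq_card_of_forall_mem_zpowers hG, Nat.card_eq_fintype_card, Fintype.card_units, hM]
  set ζ : ℂ := ψ G with hζ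
  have hζN : ζ ^ N = 1 := by
    rw [hζ, ← MulChar.pow_apply_coe, hψN, MulChar.one_apply_coe]
  have hζ1 : ζ ≠ 1 := by
    intro h
    apply hψ
    rw [MulChar.eq_one_iff]
    intro y
    obtain ⟨i, hi⟩ := hG y
    obtain ⟨n, hn⟩ := (isOfFinOrder_of_finite G).mem_zpowers_iff_mem_range_orderOf.1 (hG y) |> Finset.mem_image.1
    rw [← hn.2, Units.val_pow_eq_pow_val, map_pow, ← hζ, h, one_pow]
  have hrep : ∀ y : E, y ≠ 0 → ∃ i : ℕ, y = (G : E) ^ i := by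
    intro y hy
    obtain ⟨n, hn⟩ := (isOfFinOrder_of_finite G).mem_zpowers_iff_mem_range_orderOf.1 (hG (Units.mk0 y hy)) |> Finset.mem_image.1
    refine ⟨n, ?_⟩
    have := congrArg Units.val hn.2
    simpa using this.symm
  have hgeom : ∑ j ∈ Finset.range N, ζ ^ j = 0 := by
    have := geom_sum_mul ζ N
    rw [hζN, sub_self] at this
    exact (mul_eq_zero.1 this).resolve_right (sub_ne_zero.2 hζ1)
  have hζnorm : ‖ζ‖ = 1 := Complex.norm_eq_one_of_pow_eq_one hζN hN.ne'
  have hcong : ∀ i j : ℕ, ((G : E) ^ i) ^ M = ((G : E) ^ M) ^ j → i ≡ j [MOD N] := by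
    intro i j h
    have h1 : G ^ (i * M) = G ^ (j * M) := by
      ext; push_cast
      rw [pow_mul, h, ← pow_mul, mul_comm]
    rw [pow_eq_pow_iff_modEq, hord] at h1
    exact Nat.ModEq.mul_right_cancel' hMpos.ne' h1
  have hζcong : ∀ i j : ℕ, i ≡ j [MOD N] → ζ ^ i = ζ ^ j := by
    intro i j h
    exact pow_eq_pow_of_modEq h hζN
  let A : Finset E := (Finset.range N).image (fun j => ((G : E) ^ M) ^ j)
  let S : Finset E := Finset.univ.filter (fun x => φ x ≠ 0)
  have hmaps : ∀ x ∈ S, φ x ^ M ∈ A := by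
    intro x hx
    obtain ⟨i, hi⟩ := hrep (φ x) (by simpa [S] using hx)
    rw [Finset.mem_image]
    refine ⟨i % N, Finset.mem_range.2 (Nat.mod_lt _ hN), ?_⟩
    have h1 : G ^ (M * (i % N)) = G ^ (i * M) := by
      rw [pow_eq_pow_iff_modEq, hord, mul_comm M]
      exact Nat.ModEq.mul_right' M (Nat.mod_modEq i N)
    have h2 := congrArg Units.val h1
    push_cast at h2
    rw [hi, ← pow_mul, ← pow_mul, h2]
  have hinj : Set.InjOn (fun j => ((G : E) ^ M) ^ j) (Finset.range N : Set ℕ) := by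
    intro i hi j hj h
    have h1 := hcong i j (by rw [← pow_mul, mul_comm, pow_mul]; exact h)
    simp only [Finset.coe_range, Set.mem_Iio] at hi hj
    exact Nat.ModEq.eq_of_lt_of_lt h1 hi hj
  let n : ℕ → ℕ := fun j => (S.filter (fun x => φ x ^ M = ((G : E) ^ M) ^ j)).card
  have hnB : ∀ j, n j ≤ B := by
    intro j
    refine le_trans (Finset.card_le_card ?_) (hB (((G : E) ^ M) ^ j) ?_)
    · intro x hx
      simp only [Finset.mem_filter, Finset.mem_univ, true_and] at hx ⊢
      exact hx.2
    · rw [← pow_mul, ← pow_mul]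
      have : G ^ (M * (j * N)) = 1 := by
        rw [← orderOf_dvd_iff_pow_eq_one, hord]; exact ⟨j, by ring⟩
      have h2 := congrArg Units.val this
      push_cast at h2
      rw [← h2]
  have hsum : ∑ x, ψ (φ x) = ∑ j ∈ Finset.range N, (n j : ℂ) * ζ ^ j := by
    have h1 : ∑ x, ψ (φ x) = ∑ x ∈ S, ψ (φ x) := by
      symm
      apply Finset.sum_subset (Finset.subset_univ _)
      intro x _ hx
      have : φ x = 0 := by simpa [S] using hx
      rw [this]; exact MulChar.map_zero ψ
    rw [h1, ← Finset.sum_fiberwise_of_maps_to hmaps, Finset.sum_image hinj]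
    apply Finset.sum_congr rfl
    intro j _
    rw [Finset.sum_congr rfl (g := fun _ => ζ ^ j)]
    · rw [Finset.sum_const, nsmul_eq_mul]
    · intro x hx
      simp only [Finset.mem_filter, S, Finset.mem_univ, true_and] at hx
      obtain ⟨i, hi⟩ := hrep (φ x) hx.1
      rw [hi, map_pow, ← hζ]
      apply hζcong
      apply hcong
      rw [← hi, hx.2]
  have hcardS : ∑ j ∈ Finset.range N, n j = S.card := by
    rw [Finset.card_eq_sum_card_fiberwise hmaps, Finset.sum_image hinj]
  have hcardE : S.card + (Finset.univ.filter (fun x => φ x = 0)).card = Fintype.card E := by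
    rw [add_comm, ← Finset.card_univ]
    exact Finset.card_filter_add_card_filter_not (s := Finset.univ) (fun x => φ x = 0)
  have h3 : ∑ x, ψ (φ x) = - ∑ j ∈ Finset.range N, (((B : ℝ) - n j : ℝ) : ℂ) * ζ ^ j := by
    rw [hsum]
    push_cast
    simp only [sub_mul, Finset.sum_sub_distrib]
    rw [← Finset.mul_sum, hgeom]; ring
  rw [h3, norm_neg]
  refine (norm_sum_le _ _).trans ?_
  have h4 : ∀ j ∈ Finset.range N, ‖(((B : ℝ) - n j : ℝ) : ℂ) * ζ ^ j‖ = (B : ℝ) - n j := by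
    intro j _
    rw [norm_mul, norm_pow, hζnorm, one_pow, mul_one, Complex.norm_real, Real.norm_eq_abs, abs_of_nonneg]
    have := hnB j
    rw [sub_nonneg]; exact_mod_cast this
  rw [Finset.sum_congr rfl h4, Finset.sum_sub_distrib, Finset.sum_const, Finset.card_range, nsmul_eq_mul,
    ← Nat.cast_sum, hcardS, ← hcardE]
  push_cast
  linarith


lemma wm_prod_nf {F : Type*} [Field F] (f : F[X]) (hf : f.Monic) [DecidableEq F] :
    (UniqueFactorizationMonoid.normalizedFactors f).prod = f := by
  rw [UniqueFactorizationMonoid.prod_normalizedFactors_eq hf.ne_zero, hf.normalize_eq_self]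

lemma wm_reduce {F : Type*} [Field F] (N : ℕ) (hN : 0 < N) (f : F[X]) (hf : f.Monic) (P0 : F[X])
    (hP0 : Irreducible P0) (hP0N : ¬ N ∣ multiplicity P0 f) :
    ∃ (k N' : ℕ) (g : F[X]), 0 < k ∧ 2 ≤ N' ∧ N = k * N' ∧ g.Monic ∧ f = g ^ k ∧
      ∀ c : ℕ, (∀ P : F[X], Irreducible P → N' ∣ c * multiplicity P g) → N' ∣ c := by
  classical
  set s := UniqueFactorizationMonoid.normalizedFactors f with hs
  set G := s.toFinset.gcd (fun P => s.count P) with hG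
  set k := N.gcd G with hk
  have hkpos : 0 < k := Nat.gcd_pos_of_pos_left _ hN
  obtain ⟨N', hN'⟩ : k ∣ N := Nat.gcd_dvd_left _ _
  obtain ⟨t, ht⟩ := Multiset.exists_smul_of_dvd_count s (k := k) (by
    intro a ha
    exact (Nat.gcd_dvd_right _ _).trans (Finset.gcd_dvd (by simpa using ha)))
  have hfg : f = t.prod ^ k := by
    rw [← wm_prod_nf f hf, ← hs, ht, Multiset.prod_nsmul]
  have hts : ∀ P ∈ t, P ∈ s := by
    intro P hP
    rw [ht, Multiset.mem_nsmul]
    exact ⟨hkpos.ne', hP⟩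
  have hmon : ∀ P ∈ s, P.Monic := by
    intro P hP
    exact ((Polynomial.mem_normalizedFactors_iff hf.ne_zero).1 hP).2.1
  have hgm : t.prod.Monic := by
    have := monic_multiset_prod_of_monic t id (fun P hP => hmon P (hts P hP))
    simpa using this
  have hmul : ∀ P, Irreducible P → multiplicity P f = k * multiplicity P t.prod := by
    intro P hP
    rw [hfg, FiniteMultiplicity.multiplicity_pow hP.prime]
    exact FiniteMultiplicity.of_prime_left hP.prime hgm.ne_zero
  refine ⟨k, N', t.prod, hkpos, ?_, hN', hgm, hfg, ?_⟩
  · by_contra h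
    have h1 : N' ≠ 0 := by rintro rfl; omega
    have h2 : N' = 1 := by omega
    rw [h2, mul_one] at hN'
    apply hP0N
    rw [hmul P0 hP0, ← hN']
    exact dvd_mul_right _ _
  · intro c hc
    have h1 : ∀ P ∈ s.toFinset, N ∣ c * s.count P := by
      intro P hP
      have hP' := (Polynomial.mem_normalizedFactors_iff hf.ne_zero).1 (Multiset.mem_toFinset.1 hP)
      have h2 := UniqueFactorizationMonoid.emultiplicity_eq_count_normalizedFactors hP'.1 hf.ne_zero
      rw [hP'.2.1.normalize_eq_self, (FiniteMultiplicity.of_prime_left hP'.1.prime hf.ne_zero).emultiplicity_eq_multiplicity,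
        hmul P hP'.1] at h2
      have h3 : k * multiplicity P t.prod = s.count P := by exact_mod_cast h2
      rw [← h3, hN']
      have := mul_dvd_mul_left k (hc P hP'.1)
      calc k * N' ∣ k * (c * multiplicity P t.prod) := this
        _ = _ := by ring
    have h2 : N ∣ c * G := by
      have := Finset.dvd_gcd h1
      rw [Finset.gcd_mul_left] at this
      simpa using this
    have h3 : N ∣ c * k := by
      rw [hk, ← Nat.gcd_mul_left]
      exact Nat.dvd_gcd (dvd_mul_left _ _) h2
    rw [hN', mul_comm c] at h3
    exact Nat.dvd_of_mul_dvd_mul_left hkpos h3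

lemma wm_char_bound (F : Type) [Field F] [Fintype F] (N : ℕ) (hN : 1 < N) (χ : MulChar F ℂ)
    (hχ : orderOf χ = N) (f : F[X]) (hf : f.Monic) (P0 : F[X])
    (hP0 : Irreducible P0) (hP0N : ¬ N ∣ multiplicity P0 f) :
    ∃ (C : ℝ) (u0 : ℕ), ∀ u, u0 ≤ u → ∀ (E : Type) [Field E] [Fintype E] [Algebra F E],
      Fintype.card E = (Fintype.card F ^ u) ^ 2 →
      ∀ χ' : MulChar E ℂ, (∀ x : E, χ' x = χ (Algebra.norm F x)) →
        ‖∑ x : E, χ' (aeval x f)‖ ≤ C * (Fintype.card F : ℝ) ^ u := by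
  classical
  obtain ⟨k, N', g, hk, hN', hNk, hg, hfg, hcond⟩ := wm_reduce N (by omega) f hf P0 hP0 hP0N
  set m := g.natDegree with hm
  refine ⟨N' * (2 * m + 3) + m, N' * (m + 2) ^ 2 + 10, ?_⟩
  intro u hu E _ _ _ hE χ' hχ'
  set q := Fintype.card F with hq
  have hq1 : 1 < q := Fintype.one_lt_card
  set Q := q ^ u with hQ
  have hQu : u < Q := Nat.lt_pow_self hq1
  have hNq : N ∣ q - 1 := by rw [← hχ]; exact MulChar.orderOf_dvd_card_sub_one F χ
  have hN'q : N' ∣ q - 1 := (Dvd.intro_left k hNk.symm).trans hNq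
  have hN'Q : N' ∣ Q - 1 := hN'q.trans (by simpa using Nat.sub_dvd_pow_sub_pow q 1 u)
  obtain ⟨r, hr⟩ := hN'Q
  have hr' : Q = N' * r + 1 := by omega
  set ψ : MulChar E ℂ := χ' ^ k with hψ
  have hχpow : ∀ (n : ℕ) (x : Eˣ), (χ' ^ n) x = (χ ^ n) (Algebra.norm F (x : E)) := by
    intro n x
    have hu' : IsUnit (Algebra.norm F (x : E)) := by
      rw [isUnit_iff_ne_zero, Algebra.norm_ne_zero_iff]; exact x.ne_zero
    obtain ⟨y, hy⟩ := hu'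
    rw [MulChar.pow_apply_coe, hχ', ← hy, MulChar.pow_apply_coe]
  have hψN : ψ ^ N' = 1 := by
    rw [hψ, ← pow_mul, ← hNk, MulChar.eq_one_iff]
    intro x
    rw [hχpow, ← hχ, pow_orderOf_eq_one, MulChar.one_apply]
    rw [isUnit_iff_ne_zero, Algebra.norm_ne_zero_iff]; exact x.ne_zero
  have hψ1 : ψ ≠ 1 := by
    intro h
    have h1 : χ ^ k = 1 := by
      rw [MulChar.eq_one_iff]
      intro c
      obtain ⟨y, hy⟩ := FiniteField.unitsMap_norm_surjective F E c
      have h2 := hχpow k y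
      rw [← hψ, h, MulChar.one_apply_coe] at h2
      have h3 : Algebra.norm F (y : E) = c := by rw [← hy]; rfl
      rw [h3] at h2
      exact h2.symm
    have h2 := orderOf_dvd_of_pow_eq_one h1
    rw [hχ] at h2
    have h3 := Nat.le_of_dvd hk h2
    nlinarith
  have hEcard : Fintype.card E - 1 = N' * ((Q + 1) * r) := by
    rw [hE]
    have : Q ^ 2 = N' * ((Q + 1) * r) + 1 := by
      have h5 : Q ^ 2 = (Q + 1) * (N' * r) + 1 := by
        rw [show N' * r = Q - 1 from hr.symm]
        obtain ⟨Q', hQ'⟩ : ∃ Q', Q = Q' + 1 := ⟨Q - 1, by omega⟩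
        rw [hQ', Nat.add_sub_cancel]; ring
      rw [h5]; ring
    omega
  have hmain := wm_sum_bound ψ N' ((Q + 1) * r) (Q * r + Q * (2 * m + 3)) hEcard hψN hψ1
    (fun x => aeval x g) (by
      intro a ha
      obtain ⟨c, hc⟩ := hN'q
      have h1 : a ^ q = a := by
        rw [show q = (q - 1) + 1 by omega, hc, pow_succ, pow_mul, ha, one_pow, one_mul]
      obtain ⟨b, rfl⟩ := wm_mem_range (F := F) a h1
      apply wm_stepanov N' hN' g hg hcond u Q r rfl hr' (by rw [← hm]; omega) E hE
      rintro rfl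
      rw [map_zero, zero_pow (by omega)] at ha
      exact zero_ne_one ha)
  have hS : ∑ x : E, χ' (aeval x f) = ∑ x : E, ψ (aeval x g) := by
    apply Finset.sum_congr rfl
    intro x _
    rw [hψ, MulChar.pow_apply' _ hk.ne', hfg, map_pow, map_pow]
  rw [hS]
  refine hmain.trans ?_
  have hZ : (Finset.univ.filter (fun x : E => aeval x g = 0)).card ≤ m := by
    have hmap : g.map (algebraMap F E) ≠ 0 := (hg.map _).ne_zero
    rw [hm, ← natDegree_map (algebraMap F E)]
    apply card_le_degree_of_subset_roots
    intro x hx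
    rw [mem_roots hmap, IsRoot.def, eval_map_algebraMap]
    simpa using hx
  have hZ' : ((Finset.univ.filter (fun x : E => aeval x g = 0)).card : ℝ) ≤ m := by exact_mod_cast hZ
  rw [hE]
  have hQr : (Q : ℝ) = N' * r + 1 := by exact_mod_cast hr'
  have hQ1 : (1 : ℝ) ≤ Q := by exact_mod_cast (by omega : 1 ≤ Q)
  have hQq : (q : ℝ) ^ u = Q := by rw [hQ]; push_cast; rfl
  rw [hQq]
  push_cast
  have h7 : (N' : ℝ) * (Q * r + Q * (2 * m + 3)) = Q * (Q - 1) + N' * (2 * m + 3) * Q := by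
    rw [hQr]; ring
  rw [h7]
  have hm0 : (0 : ℝ) ≤ m := by positivity
  nlinarith


lemma wm_finite_monic (F : Type*) [Field F] [Finite F] (n : ℕ) :
    {h : F[X] | h.Monic ∧ h.natDegree = n}.Finite := by
  apply Set.Finite.of_finite_image (f := fun h : F[X] => fun i : Fin (n + 1) => h.coeff i)
  · exact Set.toFinite _
  · intro a ha b hb hab
    ext i
    by_cases hi : i < n + 1
    · exact congrFun hab ⟨i, hi⟩
    · rw [coeff_eq_zero_of_natDegree_lt (by rw [ha.2]; omega),
        coeff_eq_zero_of_natDegree_lt (by rw [hb.2]; omega)]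

/-- monic polynomials of degree `n` -/
noncomputable def wmM (F : Type*) [Field F] [Finite F] (n : ℕ) : Finset F[X] :=
  (wm_finite_monic F n).toFinset

lemma wm_mem_M {F : Type*} [Field F] [Finite F] {n : ℕ} {h : F[X]} :
    h ∈ wmM F n ↔ h.Monic ∧ h.natDegree = n := by simp [wmM]

lemma wm_finite_irr (F : Type*) [Field F] [Finite F] (n : ℕ) :
    {h : F[X] | h.Monic ∧ Irreducible h ∧ h.natDegree ≤ n}.Finite := by
  apply Set.Finite.subset (Set.Finite.biUnion (Set.finite_Iic n) (fun k _ => wm_finite_monic F k))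
  intro h hh
  simp only [Set.mem_iUnion]
  exact ⟨h.natDegree, hh.2.2, hh.1, rfl⟩

/-- monic irreducible polynomials of degree at most `n` -/
noncomputable def wmB (F : Type*) [Field F] [Finite F] (n : ℕ) : Finset F[X] :=
  (wm_finite_irr F n).toFinset

lemma wm_mem_B {F : Type*} [Field F] [Finite F] {n : ℕ} {h : F[X]} :
    h ∈ wmB F n ↔ h.Monic ∧ Irreducible h ∧ h.natDegree ≤ n := by simp [wmB]

lemma wm_degree_count {F : Type*} [Field F] [Finite F] (n : ℕ) (h : F[X]) (hm : h.Monic)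
    (hn : h.natDegree = n) [DecidablePred fun x : F[X] × ℕ => x.1 ^ x.2 ∣ h] :
    ∑ x ∈ (wmB F n ×ˢ Finset.Icc 1 n) with x.1 ^ x.2 ∣ h, x.1.natDegree = n := by
  classical
  set s := UniqueFactorizationMonoid.normalizedFactors h with hs
  have hdeg : ∀ P ∈ s, P ∈ wmB F n := by
    intro P hP
    have := (Polynomial.mem_normalizedFactors_iff hm.ne_zero).1 hP
    exact wm_mem_B.2 ⟨this.2.1, this.1, hn ▸ natDegree_le_of_dvd this.2.2 hm.ne_zero⟩
  have h1 : n = ∑ P ∈ wmB F n, s.count P * P.natDegree := by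
    have h2 : h.natDegree = (s.map natDegree).sum := by
      conv_lhs => rw [← wm_prod_nf h hm]
      apply natDegree_multiset_prod
      intro h0
      exact (wm_mem_B.1 (hdeg 0 h0)).1.ne_zero rfl
    rw [hn, Finset.sum_multiset_map_count] at h2
    refine h2.trans ?_
    simp only [smul_eq_mul]
    apply Finset.sum_subset
    · intro P hP; exact hdeg P (by simpa using hP)
    · intro P _ hP
      rw [Multiset.count_eq_zero_of_notMem (by simpa using hP), zero_mul]
  conv_rhs => rw [h1]
  rw [Finset.sum_filter, Finset.sum_product]
  apply Finset.sum_congr rfl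
  intro P hP
  obtain ⟨hPm, hPi, hPn⟩ := wm_mem_B.1 hP
  have hc : ∀ r, P ^ r ∣ h ↔ r ≤ s.count P := by
    intro r
    have h2 := UniqueFactorizationMonoid.emultiplicity_eq_count_normalizedFactors hPi hm.ne_zero
    rw [hPm.normalize_eq_self, ← hs] at h2
    rw [pow_dvd_iff_le_emultiplicity, h2]
    exact_mod_cast Iff.rfl
  have hcn : s.count P ≤ n := by
    have := natDegree_le_of_dvd ((hc _).2 le_rfl) hm.ne_zero
    rw [natDegree_pow, hn] at this
    have := hPi.natDegree_pos
    nlinarith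
  rw [← Finset.sum_filter]
  have : (Finset.Icc 1 n).filter (fun r => P ^ r ∣ h) = Finset.Icc 1 (s.count P) := by
    ext r
    simp only [Finset.mem_filter, Finset.mem_Icc, hc]
    omega
  simp only
  rw [this]
  simp

/-- the power sums attached to a multiplicative function -/
noncomputable def wmS {F : Type*} [Field F] [Finite F] (lam : F[X] → ℂ) (t : ℕ) : ℂ :=
  ∑ x ∈ (wmB F t ×ˢ Finset.Icc 1 t) with x.2 * x.1.natDegree = t,
    (x.1.natDegree : ℂ) * lam x.1 ^ x.2

lemma wm_newton_id {F : Type*} [Field F] [Finite F] (lam : F[X] → ℂ) (h1 : lam 1 = 1)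
    (hmul : ∀ g h : F[X], g.Monic → h.Monic → lam (g * h) = lam g * lam h) (n : ℕ) :
    (n : ℂ) * ∑ h ∈ wmM F n, lam h =
      ∑ p ∈ Finset.HasAntidiagonal.antidiagonal n with p.1 < n,
        (∑ h ∈ wmM F p.1, lam h) * wmS lam p.2 := by
  classical
  have hpow : ∀ (g : F[X]) (r : ℕ), g.Monic → lam (g ^ r) = lam g ^ r := by
    intro g r hg
    induction r with
    | zero => simp [h1]
    | succ k ih => rw [pow_succ, hmul _ _ (hg.pow k) hg, ih, pow_succ]
  have hL : (n : ℂ) * ∑ h ∈ wmM F n, lam h =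
      ∑ x ∈ (wmB F n ×ˢ Finset.Icc 1 n) with x.2 * x.1.natDegree ≤ n,
        (x.1.natDegree : ℂ) * lam x.1 ^ x.2 * ∑ h ∈ wmM F (n - x.2 * x.1.natDegree), lam h := by
    calc (n : ℂ) * ∑ h ∈ wmM F n, lam h 
        = ∑ h ∈ wmM F n, ∑ x ∈ (wmB F n ×ˢ Finset.Icc 1 n), 
            if x.1 ^ x.2 ∣ h then (x.1.natDegree : ℂ) * lam h else 0 := by
          rw [Finset.mul_sum]
          apply Finset.sum_congr rfl
          intro h hh
          obtain ⟨hm, hn⟩ := wm_mem_M.1 hh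
          rw [← Finset.sum_filter, ← Finset.sum_mul, ← Nat.cast_sum, wm_degree_count n h hm hn]
      _ = ∑ x ∈ (wmB F n ×ˢ Finset.Icc 1 n), ∑ h ∈ wmM F n with x.1 ^ x.2 ∣ h,
            (x.1.natDegree : ℂ) * lam h := by
          rw [Finset.sum_comm]
          simp only [Finset.sum_filter]
      _ = _ := by
          rw [Finset.sum_filter]
          apply Finset.sum_congr rfl
          rintro ⟨P, r⟩ hx
          simp only [Finset.mem_product] at hx
          obtain ⟨hPm, hPi, hPn⟩ := wm_mem_B.1 hx.1
          simp only
          split_ifs with hle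
          · rw [Finset.mul_sum]
            symm
            apply Finset.sum_bij (fun h _ => P ^ r * h)
            · intro h hh
              obtain ⟨hm, hd⟩ := wm_mem_M.1 hh
              simp only [Finset.mem_filter, wm_mem_M]
              refine ⟨⟨(hPm.pow r).mul hm, ?_⟩, dvd_mul_right _ _⟩
              rw [(hPm.pow r).natDegree_mul hm, hPm.natDegree_pow, hd]; omega
            · intro a _ b _ hab
              exact mul_left_cancel₀ (hPm.pow r).ne_zero hab
            · intro b hb
              simp only [Finset.mem_filter, wm_mem_M] at hb
              obtain ⟨⟨hm, hd⟩, c, hc⟩ := hb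
              have hcm : c.Monic := (hPm.pow r).of_mul_monic_left (hc ▸ hm)
              refine ⟨c, ?_, hc.symm⟩
              rw [wm_mem_M]
              refine ⟨hcm, ?_⟩
              rw [hc, (hPm.pow r).natDegree_mul hcm, hPm.natDegree_pow] at hd; omega
            · intro h hh
              rw [hmul _ _ (hPm.pow r) (wm_mem_M.1 hh).1, hpow _ _ hPm]; ring
          · apply Finset.sum_eq_zero
            intro h hh
            exfalso
            simp only [Finset.mem_filter, wm_mem_M] at hh
            have := natDegree_le_of_dvd hh.2 hh.1.1.ne_zero
            rw [hPm.natDegree_pow, hh.1.2] at this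
            exact hle this
  rw [hL]
  have hmaps : ∀ x ∈ (wmB F n ×ˢ Finset.Icc 1 n).filter (fun x => x.2 * x.1.natDegree ≤ n),
      ((n - x.2 * x.1.natDegree, x.2 * x.1.natDegree) : ℕ × ℕ) ∈ 
        (Finset.HasAntidiagonal.antidiagonal n).filter (fun p => p.1 < n) := by
    rintro ⟨P, r⟩ hx
    simp only [Finset.mem_filter, Finset.mem_product, Finset.mem_Icc, wm_mem_B] at hx
    simp only [Finset.mem_filter, Finset.HasAntidiagonal.mem_antidiagonal]
    have := hx.1.1.2.1.natDegree_pos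
    have : 0 < r * P.natDegree := Nat.mul_pos (by omega) this
    omega
  rw [← Finset.sum_fiberwise_of_maps_to hmaps]
  apply Finset.sum_congr rfl
  rintro ⟨i, t⟩ hp
  simp only [Finset.mem_filter, Finset.HasAntidiagonal.mem_antidiagonal] at hp
  rw [wmS, Finset.mul_sum]
  have hset : ((wmB F n ×ˢ Finset.Icc 1 n).filter (fun x => x.2 * x.1.natDegree ≤ n)).filter
      (fun x => ((n - x.2 * x.1.natDegree, x.2 * x.1.natDegree) : ℕ × ℕ) = (i, t)) =
      (wmB F t ×ˢ Finset.Icc 1 t).filter (fun x => x.2 * x.1.natDegree = t) := by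
    ext ⟨P, r⟩
    simp only [Finset.mem_filter, Finset.mem_product, Finset.mem_Icc, wm_mem_B, Prod.mk.injEq]
    constructor
    · rintro ⟨⟨⟨⟨a, b, c⟩, e, f⟩, g⟩, j, k⟩
      have := b.natDegree_pos
      refine ⟨⟨⟨a, b, ?_⟩, e, ?_⟩, k⟩ <;> nlinarith
    · rintro ⟨⟨⟨a, b, c⟩, e, f⟩, g⟩
      refine ⟨⟨⟨⟨a, b, by omega⟩, e, by omega⟩, by omega⟩, by omega, g⟩
  simp only at hset ⊢
  rw [hset]
  apply Finset.sum_congr rfl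
  rintro ⟨P, r⟩ hx
  simp only [Finset.mem_filter] at hx ⊢
  rw [hx.2, show n - t = i by omega]; ring


lemma wm_res_map {F K : Type*} [Field F] [Field K] [Algebra F K] [IsAlgClosed K] (p f : F[X])
    (hp : p.Monic) :
    algebraMap F K (resultant p f) = ((p.aroots K).map (fun a => aeval a f)).prod := by
  rw [← resultant_map_map]
  have h := resultant_eq_prod_eval (p.map (algebraMap F K)) (f.map (algebraMap F K)) f.natDegree
    (natDegree_map_le) (IsAlgClosed.splits _)
  rw [natDegree_map] at h
  rw [h, (hp.map _).leadingCoeff, one_pow, one_mul]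
  simp only [eval_map_algebraMap, aroots]

lemma wm_norm_simple {F L : Type*} [Field F] [Finite F] [Field L] [Finite L] [Algebra F L] (x : L)
    (f : F[X]) (n r : ℕ) (hn : Module.finrank F L = n) (hr : r * (minpoly F x).natDegree = n) :
    Algebra.norm F (aeval x f) = resultant (minpoly F x) f ^ r := by
  classical
  have hx : IsIntegral F x := Algebra.IsIntegral.isIntegral x
  set y : IntermediateField.adjoin F {x} := aeval (IntermediateField.AdjoinSimple.gen F x) f with hy
  have hxy : aeval x f = algebraMap _ L y := by
    rw [hy, ← aeval_algebraMap_apply]; rfl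
  have hfr : Module.finrank (IntermediateField.adjoin F {x}) L = r := by
    have h1 := Module.finrank_mul_finrank F (IntermediateField.adjoin F {x}) L
    rw [IntermediateField.adjoin.finrank hx, hn, ← hr, mul_comm] at h1
    exact Nat.eq_of_mul_eq_mul_right (minpoly.natDegree_pos hx) h1
  rw [← Algebra.norm_norm (S := IntermediateField.adjoin F {x}), hxy, Algebra.norm_algebraMap, hfr,
    map_pow]
  congr 1
  let K := AlgebraicClosure F
  apply (algebraMap F K).injective
  rw [Algebra.norm_eq_prod_embeddings, wm_res_map _ _ (minpoly.monic hx)]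
  have hnd : ((minpoly F x).aroots K).Nodup :=
    nodup_roots (Separable.map (Algebra.IsSeparable.isSeparable F x))
  rw [Fintype.prod_equiv (IntermediateField.algHomAdjoinIntegralEquiv F hx (K := K)) _
    (fun a => aeval (a : K) f)]
  · have : ((minpoly F x).aroots K) = ((minpoly F x).aroots K).toFinset.val := by
      rw [Multiset.toFinset_val, Multiset.dedup_eq_self.2 hnd]
    conv_rhs => rw [this]
    change _ = ∏ a ∈ ((minpoly F x).aroots K).toFinset, aeval a f
    exact (Finset.prod_subtype ((minpoly F x).aroots K).toFinset
      (p := fun a => a ∈ (minpoly F x).aroots K) (fun a => Multiset.mem_toFinset)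
      (fun a => aeval a f)).symm
  · intro σ
    rw [hy, ← Polynomial.aeval_algHom_apply]
    rfl

lemma wm_point_sum {F : Type*} [Field F] [Fintype F] (χ : MulChar F ℂ) (f : F[X]) (t : ℕ)
    (ht : 0 < t) (E : Type*) [Field E] [Fintype E] [Algebra F E]
    (hE : Fintype.card E = Fintype.card F ^ t) :
    ∑ x : E, χ (Algebra.norm F (aeval x f)) = wmS (fun h => χ (resultant h f)) t := by
  classical
  have hfr : Module.finrank F E = t := by
    have := Module.card_eq_pow_finrank (K := F) (V := E)
    rw [hE] at this
    exact (Nat.pow_right_injective Fintype.one_lt_card this).symm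
  have hdeg : ∀ x : E, (minpoly F x).natDegree ∣ t := by
    intro x
    rw [← hfr]
    exact minpoly.degree_dvd (Algebra.IsIntegral.isIntegral x)
  have hmaps : ∀ x ∈ (Finset.univ : Finset E),
      (minpoly F x, t / (minpoly F x).natDegree) ∈
        (wmB F t ×ˢ Finset.Icc 1 t).filter (fun x => x.2 * x.1.natDegree = t) := by
    intro x _
    have hx : IsIntegral F x := Algebra.IsIntegral.isIntegral x
    simp only [Finset.mem_filter, Finset.mem_product, Finset.mem_Icc, wm_mem_B]
    have h1 := Nat.le_of_dvd ht (hdeg x)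
    exact ⟨⟨⟨minpoly.monic hx, minpoly.irreducible hx, h1⟩,
      Nat.div_pos h1 (minpoly.natDegree_pos hx), Nat.div_le_self _ _⟩, Nat.div_mul_cancel (hdeg x)⟩
  rw [← Finset.sum_fiberwise_of_maps_to hmaps, wmS]
  apply Finset.sum_congr rfl
  rintro ⟨P, r⟩ hPr
  simp only [Finset.mem_filter, Finset.mem_product, Finset.mem_Icc, wm_mem_B] at hPr
  obtain ⟨⟨⟨hPm, hPi, hPt⟩, hr1, hrt⟩, hrP⟩ := hPr
  have hfib : (Finset.univ.filter
      (fun x : E => (minpoly F x, t / (minpoly F x).natDegree) = (P, r))) =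
      (P.rootSet E).toFinset := by
    ext x
    simp only [Finset.mem_filter, Finset.mem_univ, true_and, Set.mem_toFinset, Prod.mk.injEq,
      mem_rootSet]
    constructor
    · rintro ⟨rfl, _⟩
      exact ⟨hPm.ne_zero, minpoly.aeval _ _⟩
    · rintro ⟨_, h⟩
      have := minpoly.eq_of_irreducible_of_monic hPi h hPm
      refine ⟨this.symm, ?_⟩
      rw [← this, ← hrP]
      exact Nat.mul_div_cancel _ hPi.natDegree_pos
  have hsplit : (P.map (algebraMap F E)).Splits := by
    have h1 : P ∣ X ^ (Nat.card F) ^ t - X :=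
      hPi.natDegree_dvd_iff_dvd_X_pow_card_pow_sub_X.1 ⟨r, by rw [mul_comm]; exact hrP.symm⟩
    rw [Nat.card_eq_fintype_card, ← hE] at h1
    have h2 := map_dvd (mapRingHom (algebraMap F E)) h1
    simp only [coe_mapRingHom, Polynomial.map_sub, Polynomial.map_pow, map_X] at h2
    refine Splits.of_dvd ?_ (FiniteField.X_pow_card_sub_X_ne_zero E Fintype.one_lt_card) h2
    rw [splits_iff_card_roots, FiniteField.roots_X_pow_card_sub_X,
      FiniteField.X_pow_card_sub_X_natDegree_eq E Fintype.one_lt_card]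
    rfl
  have hcard : (P.rootSet E).toFinset.card = P.natDegree := by
    rw [Set.toFinset_card]
    exact card_rootSet_eq_natDegree (PerfectField.separable_of_irreducible hPi) hsplit
  have hval : ∀ x ∈ Finset.univ.filter
      (fun x : E => (minpoly F x, t / (minpoly F x).natDegree) = (P, r)),
      χ (Algebra.norm F (aeval x f)) = χ (resultant P f) ^ r := by
    intro x hx
    simp only [Finset.mem_filter, Finset.mem_univ, true_and, Prod.mk.injEq] at hx
    rw [wm_norm_simple x f t r hfr (by rw [hx.1]; exact hrP), hx.1, map_pow]
  rw [Finset.sum_congr rfl hval, Finset.sum_const, hfib, hcard, nsmul_eq_mul]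


lemma wm_exists_twist {F : Type*} [Field F] [Finite F] (N : ℕ) (χ : MulChar F ℂ)
    (hχ : orderOf χ = N) (f : F[X]) (hf : f.Monic) (P0 : F[X]) (hP0m : P0.Monic)
    (hP0 : Irreducible P0) (hP0N : ¬ N ∣ multiplicity P0 f) :
    ∃ u : F[X], IsCoprime f u ∧ χ (resultant f u) ≠ 1 := by
  classical
  set e := multiplicity P0 f with he
  have hχe : χ ^ e ≠ 1 := by
    intro h
    exact hP0N (hχ ▸ orderOf_dvd_of_pow_eq_one h)
  obtain ⟨c, hc⟩ := MulChar.ne_one_iff.1 hχe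
  rw [MulChar.pow_apply_coe, ← map_pow] at hc
  have : Fact (Irreducible P0) := ⟨hP0⟩
  have hfin : Module.Finite F (AdjoinRoot P0) := (AdjoinRoot.powerBasis hP0m.ne_zero).finite
  have hfin' : Finite (AdjoinRoot P0) := Module.finite_of_finite F
  obtain ⟨z, hz⟩ := FiniteField.norm_surjective F (AdjoinRoot P0) (c : F)
  obtain ⟨v, rfl⟩ := AdjoinRoot.mk_surjective z
  have hnorm : (c : F) = resultant P0 v := by
    have hmin : minpoly F (AdjoinRoot.root P0) = P0 := by
      rw [AdjoinRoot.minpoly_root hP0m.ne_zero, hP0m.leadingCoeff]; simp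
    have h1 := wm_norm_simple (AdjoinRoot.root P0) v P0.natDegree 1
      (by rw [(AdjoinRoot.powerBasis hP0m.ne_zero).finrank, AdjoinRoot.powerBasis_dim])
      (by rw [hmin, one_mul])
    rw [hmin, pow_one, AdjoinRoot.aeval_eq, hz] at h1
    exact h1
  obtain ⟨f1, hf1, hndvd⟩ := (FiniteMultiplicity.of_prime_left hP0.prime
    hf.ne_zero).exists_eq_pow_mul_and_not_dvd
  rw [← he] at hf1
  have hf1m : f1.Monic := (hP0m.pow e).of_mul_monic_left (hf1 ▸ hf)
  obtain ⟨a, b, hab⟩ := (hP0.coprime_iff_not_dvd).2 hndvd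
  set u := v * b * f1 + a * P0 with hu
  have hres : resultant f u = (c : F) ^ e := by
    apply (algebraMap F (AlgebraicClosure F)).injective
    rw [wm_res_map _ _ hf, map_pow, hnorm, wm_res_map _ _ hP0m, hf1,
      aroots_mul (mul_ne_zero (hP0m.pow e).ne_zero hf1m.ne_zero), aroots_pow, Multiset.map_add,
      Multiset.prod_add, Multiset.map_nsmul, Multiset.prod_nsmul]
    have h1 : ((f1.aroots (AlgebraicClosure F)).map (fun x => aeval x u)).prod = 1 := by
      apply Multiset.prod_eq_one
      intro y hy
      obtain ⟨x, hx, rfl⟩ := Multiset.mem_map.1 hy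
      have hx' : aeval x f1 = 0 := (mem_aroots.1 hx).2
      have h2 := congrArg (aeval x) hab
      simp only [map_add, map_mul, map_one, hx', mul_zero, add_zero] at h2
      simp [hu, hx', h2]
    have h2 : (P0.aroots (AlgebraicClosure F)).map (fun x => aeval x u) =
        (P0.aroots (AlgebraicClosure F)).map (fun x => aeval x v) := by
      apply Multiset.map_congr rfl
      intro x hx
      have hx' : aeval x P0 = 0 := (mem_aroots.1 hx).2
      have h2 := congrArg (aeval x) hab
      simp only [map_add, map_mul, map_one, hx', mul_zero, zero_add] at h2
      simp [hu, hx', mul_assoc, h2]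
    rw [h1, h2, mul_one]
  refine ⟨u, ?_, by rw [hres]; exact hc⟩
  rw [← isUnit_resultant_iff_isCoprime hf, hres]
  exact (c.isUnit).pow e

lemma wm_res_twist {F : Type*} [Field F] (f R u h h' : F[X]) (hf : f.Monic) (k : ℕ)
    (hfR : f ∣ R ^ k) (hdvd : R ∣ h' - u * h) :
    resultant f h' = resultant f u * resultant f h := by
  apply (algebraMap F (AlgebraicClosure F)).injective
  rw [map_mul, wm_res_map _ _ hf, wm_res_map _ _ hf, wm_res_map _ _ hf, ← Multiset.prod_map_mul]
  congr 1
  apply Multiset.map_congr rfl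
  intro x hx
  have hx' : aeval x f = 0 := (mem_aroots.1 hx).2
  have hR : aeval x R = 0 := by
    obtain ⟨w, hw⟩ := hfR
    have := congrArg (aeval x) hw
    rw [map_pow, map_mul, hx', zero_mul] at this
    exact eq_zero_of_pow_eq_zero this
  obtain ⟨w, hw⟩ := hdvd
  have := congrArg (aeval x) hw
  rw [map_sub, map_mul, map_mul, hR, zero_mul, sub_eq_zero] at this
  exact this

lemma wm_vanish {F : Type*} [Field F] [Finite F] (χ : MulChar F ℂ) (f R u : F[X])
    (hf : f.Monic) (hR : R.Monic) (k : ℕ) (hfR : f ∣ R ^ k) (hRf : R ∣ f)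
    (hu : IsCoprime f u)
    (hχu : χ (resultant f u) ≠ 1) (n : ℕ) (hn : R.natDegree ≤ n) :
    ∑ h ∈ wmM F n, χ (resultant h f) = 0 := by
  classical
  let T : F[X] → F[X] := fun h => R * (h /ₘ R) + (u * (h %ₘ R)) %ₘ R
  have hmod : ∀ h, R ∣ T h - u * h := by
    intro h
    have h1 := modByMonic_add_div h R
    have h2 := modByMonic_add_div (u * (h %ₘ R)) R
    refine ⟨h /ₘ R - (u * (h %ₘ R)) /ₘ R - u * (h /ₘ R), ?_⟩
    simp only [T]
    linear_combination h2 + u * h1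
  have hdeg : ∀ p, ((u * p) %ₘ R).degree < R.degree := fun p => degree_modByMonic_lt _ hR
  have hRn : R.degree ≤ n := by
    rw [degree_eq_natDegree hR.ne_zero]; exact_mod_cast hn
  have hmaps : ∀ h ∈ wmM F n, T h ∈ wmM F n := by
    intro h hh
    obtain ⟨hm, hd⟩ := wm_mem_M.1 hh
    have hdh : h.degree = n := by rw [degree_eq_natDegree hm.ne_zero, hd]
    have : T h = h + ((u * (h %ₘ R)) %ₘ R - h %ₘ R) := by
      have h1 := modByMonic_add_div h R
      simp only [T]; linear_combination h1
    have hlt : ((u * (h %ₘ R)) %ₘ R - h %ₘ R).degree < h.degree := by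
      rw [hdh]
      exact ((degree_sub_le _ _).trans_lt (max_lt (hdeg _) (degree_modByMonic_lt _ hR))).trans_le hRn
    rw [wm_mem_M, this]
    exact ⟨hm.add_of_left hlt, by rw [natDegree_add_eq_left_of_degree_lt hlt, hd]⟩
  have hinj : Set.InjOn T (wmM F n) := by
    intro a _ b _ hab
    have hquot : ∀ h, T h /ₘ R = h /ₘ R ∧ T h %ₘ R = (u * (h %ₘ R)) %ₘ R := by
      intro h
      exact div_modByMonic_unique _ _ hR ⟨by simp only [T]; ring, hdeg _⟩
    have h1 : a /ₘ R = b /ₘ R := by rw [← (hquot a).1, ← (hquot b).1, hab]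
    have h2 : (u * (a %ₘ R)) %ₘ R = (u * (b %ₘ R)) %ₘ R := by
      rw [← (hquot a).2, ← (hquot b).2, hab]
    have h3 : R ∣ u * (a %ₘ R - b %ₘ R) := by
      rw [← modByMonic_eq_zero_iff_dvd hR, mul_sub, sub_modByMonic, h2, sub_self]
    have hcop : IsCoprime R u := hu.of_isCoprime_of_dvd_left hRf
    have h4 := hcop.dvd_of_dvd_mul_left h3
    have h5 : a %ₘ R - b %ₘ R = 0 := by
      by_contra hne
      exact absurd (degree_le_of_dvd h4 hne) (not_le.2
        ((degree_sub_le _ _).trans_lt (max_lt (degree_modByMonic_lt _ hR) (degree_modByMonic_lt _ hR))))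
    rw [← modByMonic_add_div a R, ← modByMonic_add_div b R, h1, sub_eq_zero.1 h5]
  have hval : ∀ h ∈ wmM F n, χ (resultant (T h) f) = χ (resultant f u) * χ (resultant h f) := by
    intro h hh
    obtain ⟨hm, hd⟩ := wm_mem_M.1 hh
    obtain ⟨hm', hd'⟩ := wm_mem_M.1 (hmaps h hh)
    rw [resultant_comm, resultant_comm h f, hd', hd, ← map_mul]
    have := wm_res_twist f R u h (T h) hf k hfR (hmod h)
    rw [hd, hd'] at this
    rw [this]
    congr 1; ring
  have hsum : ∑ h ∈ wmM F n, χ (resultant (T h) f) = ∑ h ∈ wmM F n, χ (resultant h f) := by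
    apply Finset.sum_bij (fun h _ => T h) hmaps (fun a ha b hb hab => hinj ha hb hab)
    · exact fun b hb => by
        obtain ⟨a, ha, hab⟩ := Finset.surjOn_of_injOn_of_card_le T hmaps hinj le_rfl hb
        exact ⟨a, ha, hab⟩
    · intro a _; rfl
  rw [Finset.sum_congr rfl hval, ← Finset.mul_sum] at hsum
  have : (χ (resultant f u) - 1) * ∑ h ∈ wmM F n, χ (resultant h f) = 0 := by
    linear_combination hsum
  exact (mul_eq_zero.1 this).resolve_left (sub_ne_zero.2 hχu)


lemma wm_exists_P0 {F K : Type*} [Field F] [Field K] [Algebra F K] (N : ℕ) (f : F[X])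
    (hf : f.Monic) (hNpow : ¬ ∃ g : K[X], f.map (algebraMap F K) = g ^ N) :
    ∃ P0 : F[X], P0.Monic ∧ Irreducible P0 ∧ ¬ N ∣ multiplicity P0 f := by
  classical
  by_contra hcon
  push Not at hcon
  apply hNpow
  set s := UniqueFactorizationMonoid.normalizedFactors f with hs
  obtain ⟨t, ht⟩ := Multiset.exists_smul_of_dvd_count s (k := N) (by
    intro P hP
    have hP' := (Polynomial.mem_normalizedFactors_iff hf.ne_zero).1 hP
    have h2 := UniqueFactorizationMonoid.multiplicity_eq_count_normalizedFactors hP'.1 hf.ne_zero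
    rw [hP'.2.1.normalize_eq_self] at h2
    rw [hs, ← h2]
    exact hcon P hP'.2.1 hP'.1)
  refine ⟨t.prod.map (algebraMap F K), ?_⟩
  rw [← Polynomial.map_pow, ← Multiset.prod_nsmul, ← ht, hs, wm_prod_nf f hf]

lemma wm_exists_R {F : Type*} [Field F] [Finite F] (f : F[X])
    (hf : f.Monic) : ∃ (R : F[X]) (k : ℕ), R.Monic ∧ R ∣ f ∧ f ∣ R ^ k ∧
      R.natDegree = Set.ncard {x : AlgebraicClosure F | Polynomial.aeval x f = 0} := by
  classical
  set s := UniqueFactorizationMonoid.normalizedFactors f with hs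
  have hmon : ∀ P ∈ s, P.Monic := fun P hP =>
    ((Polynomial.mem_normalizedFactors_iff hf.ne_zero).1 hP).2.1
  have hRm : (UniqueFactorizationMonoid.radical f).Monic := by
    rw [UniqueFactorizationMonoid.radical]
    apply monic_prod_of_monic
    intro P hP
    exact hmon P (UniqueFactorizationMonoid.mem_primeFactors.1 hP)
  have hdvd : f ∣ (UniqueFactorizationMonoid.radical f) ^ s.card := by
    conv_lhs => rw [← wm_prod_nf f hf]
    have : ∀ t : Multiset F[X], (∀ P ∈ t, P ∣ UniqueFactorizationMonoid.radical f) →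
        t.prod ∣ (UniqueFactorizationMonoid.radical f) ^ t.card := by
      intro t
      induction t using Multiset.induction_on with
      | empty => simp
      | cons P t ih =>
        intro h
        rw [Multiset.prod_cons, Multiset.card_cons, pow_succ']
        exact mul_dvd_mul (h P (Multiset.mem_cons_self _ _))
          (ih (fun Q hQ => h Q (Multiset.mem_cons_of_mem hQ)))
    apply this
    intro P hP
    have hP' := (Polynomial.mem_normalizedFactors_iff hf.ne_zero).1 hP
    exact (UniqueFactorizationMonoid.dvd_radical_iff_of_irreducible hP'.1 hf.ne_zero).2 hP'.2.2
  refine ⟨UniqueFactorizationMonoid.radical f, s.card, hRm,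
    UniqueFactorizationMonoid.radical_dvd_self, hdvd, ?_⟩
  have hset : {x : AlgebraicClosure F | Polynomial.aeval x f = 0} =
      (UniqueFactorizationMonoid.radical f).rootSet (AlgebraicClosure F) := by
    ext x
    rw [Set.mem_ofPred_eq, mem_rootSet]
    constructor
    · intro hx
      refine ⟨hRm.ne_zero, ?_⟩
      obtain ⟨w, hw⟩ := hdvd
      have := congrArg (aeval x) hw
      rw [map_pow, map_mul, hx, zero_mul] at this
      exact eq_zero_of_pow_eq_zero this
    · rintro ⟨_, hx⟩
      exact aeval_eq_zero_of_dvd_aeval_eq_zero UniqueFactorizationMonoid.radical_dvd_self hx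
  rw [hset, ← Nat.card_coe_set_eq, Nat.card_eq_fintype_card]
  exact (card_rootSet_eq_natDegree (PerfectField.separable_iff_squarefree.2
    UniqueFactorizationMonoid.squarefree_radical) (IsAlgClosed.splits _)).symm

lemma wm_exists_w (F : Type) [Field F] [Fintype F] (N : ℕ) (χ : MulChar F ℂ) (hχ : orderOf χ = N)
    (f : F[X]) (hf : f.Monic) (P0 : F[X]) (hP0m : P0.Monic)
    (hP0 : Irreducible P0) (hP0N : ¬ N ∣ multiplicity P0 f) (d : ℕ)
    (hd : d = Set.ncard {x : AlgebraicClosure F | Polynomial.aeval x f = 0}) (hd2 : 2 ≤ d) :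
    ∃ w : Fin (d - 1) → ℂ, ∀ t, 0 < t →
      wmS (fun h : F[X] => χ (resultant h f)) t = - ∑ j, w j ^ t := by
  obtain ⟨R, k, hR, hRf, hfR, hRd⟩ := wm_exists_R f hf
  obtain ⟨u, hu, hχu⟩ := wm_exists_twist N χ hχ f hf P0 hP0m hP0 hP0N
  have h1 : χ (resultant (1 : F[X]) f) = 1 := by simp
  apply wm_newton (d - 1) (fun n => ∑ h ∈ wmM F n, χ (resultant h f))
  · have : wmM F 0 = {1} := by
      ext h
      rw [wm_mem_M, Finset.mem_singleton]
      constructor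
      · rintro ⟨hm, hd⟩; exact eq_one_of_monic_natDegree_zero hm hd
      · rintro rfl; exact ⟨monic_one, natDegree_one⟩
    simp only [this, Finset.sum_singleton]
    exact h1
  · intro n hn
    exact wm_vanish χ f R u hf hR k hfR hRf hu hχu n (by omega)
  · intro n _
    apply wm_newton_id (fun h : F[X] => χ (resultant h f)) h1
    intro g h hg hh
    rw [hg.natDegree_mul hh, resultant_mul_left _ _ _ _ le_rfl, map_mul]

/-- the lift of a multiplicative character -/
noncomputable def wmLift {F E : Type} [Field F] [Field E] [Finite E] [Algebra F E]
    (χ : MulChar F ℂ) : MulChar E ℂ where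
  toMonoidHom := χ.toMonoidHom.comp (Algebra.norm F)
  map_nonunit' := by
    intro a ha
    have h0 : a = 0 := by
      by_contra h; exact ha (isUnit_iff_ne_zero.2 h)
    have : Module.Finite F E := Module.Finite.of_finite
    subst h0
    change χ (Algebra.norm F (0 : E)) = 0
    rw [Algebra.norm_zero]
    exact χ.map_nonunit (by simp)

lemma wm_w_bound (F : Type) [Field F] [Fintype F] (N : ℕ) (hN : 1 < N) (χ : MulChar F ℂ)
    (hχ : orderOf χ = N)
    (f : F[X]) (hf : f.Monic) (P0 : F[X])
    (hP0 : Irreducible P0) (hP0N : ¬ N ∣ multiplicity P0 f) (D : ℕ) (w : Fin D → ℂ)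
    (hw : ∀ t, 0 < t → wmS (fun h : F[X] => χ (resultant h f)) t = - ∑ j, w j ^ t) :
    ∀ j, ‖w j‖ ≤ Real.sqrt (Fintype.card F) := by
  classical
  obtain ⟨C, u0, hC⟩ := wm_char_bound F N hN χ hχ f hf P0 hP0 hP0N
  set q := Fintype.card F with hq
  have hq1 : 1 < q := Fintype.one_lt_card
  have hq0 : (0 : ℝ) < q := by exact_mod_cast (by omega : 0 < q)
  have hb := wm_bound D (fun j => w j ^ 2 / (q : ℂ)) C (u0 + 1) (by
    intro n hn
    let p := ringChar F
    have hp : Fact p.Prime := ⟨CharP.char_is_prime F p⟩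
    let E := FiniteField.Extension F p (n * 2)
    have : NeZero (n * 2) := ⟨by omega⟩
    letI : Fintype E := Fintype.ofFinite E
    have hcard : Fintype.card E = q ^ (n * 2) := by
      rw [← Nat.card_eq_fintype_card, FiniteField.natCard_extension, Nat.card_eq_fintype_card]
    have h1 := hC n (by omega) E (by rw [hcard, pow_mul]) (wmLift χ) (fun x => rfl)
    have h2 : ∑ x : E, (wmLift χ : MulChar E ℂ) (aeval x f) = - ∑ j, w j ^ (n * 2) := by
      rw [← hw (n * 2) (by omega), ← wm_point_sum χ f (n * 2) (by omega) E hcard]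
      rfl
    rw [h2, norm_neg] at h1
    have h3 : ∑ j, (w j ^ 2 / (q : ℂ)) ^ n = (∑ j, w j ^ (n * 2)) / (q : ℂ) ^ n := by
      rw [Finset.sum_div]
      apply Finset.sum_congr rfl
      intro j _
      rw [div_pow, ← pow_mul, mul_comm]
    rw [h3, norm_div, norm_pow, Complex.norm_natCast, div_le_iff₀ (by positivity)]
    exact h1)
  intro j
  have h := hb j
  rw [norm_div, norm_pow, Complex.norm_natCast, div_le_one hq0] at h
  exact Real.le_sqrt_of_sq_le h

end WeilAux

open Polynomial in
/-- The Weil bound for multiplicative character sums: if `χ` is a multiplicative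
character of `𝔽_q` of order `N > 1` and `f` is a monic polynomial of positive degree
over `𝔽_q` that is not an `N`-th power of a polynomial over the algebraic closure, with
`d ≥ 2` distinct roots in its splitting field, then there exist complex numbers
`w₁, …, w_{d-1}` such that for every `t ≥ 1`,
`Σ_{x∈𝔽_{q^t}} χ'(f(x)) = -w₁^t - ⋯ - w_{d-1}^t`, where `χ'` is the lift of `χ` to
`𝔽_{q^t}`; in particular `|Σ_{x∈𝔽_{q^t}} χ'(f(x))| ≤ (d-1) q^{t/2}`. -/
theorem weil_mult_char_sum
    (F : Type) [Field F] [Fintype F]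
    (N : ℕ) (hN : 1 < N) (χ : MulChar F ℂ) (hχ : orderOf χ = N)
    (f : F[X]) (hmonic : f.Monic) (hdeg : 0 < f.natDegree)
    (hNpow : ¬ ∃ g : (AlgebraicClosure F)[X],
      f.map (algebraMap F (AlgebraicClosure F)) = g ^ N)
    (d : ℕ)
    (hd : d = Set.ncard {x : AlgebraicClosure F | Polynomial.aeval x f = 0})
    (hd2 : 2 ≤ d) :
    ∃ w : Fin (d - 1) → ℂ,
      ∀ t : ℕ, 0 < t →
        ∀ (E : Type) [Field E] [Fintype E] [Algebra F E],
          Fintype.card E = Fintype.card F ^ t →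
          ∀ χ' : MulChar E ℂ, (∀ x : E, χ' x = χ (Algebra.norm F x)) →
            (∑ x : E, χ' (Polynomial.aeval x f)) = -∑ j : Fin (d - 1), w j ^ t ∧
              ‖∑ x : E, χ' (Polynomial.aeval x f)‖ ≤
                (d - 1 : ℝ) * Real.sqrt ((Fintype.card F : ℝ) ^ t) := by
  obtain ⟨P0, hP0m, hP0, hP0N⟩ := wm_exists_P0 N f hmonic hNpow
  obtain ⟨w, hw⟩ := wm_exists_w F N χ hχ f hmonic P0 hP0m hP0 hP0N d hd hd2
  have hwb := wm_w_bound F N hN χ hχ f hmonic P0 hP0 hP0N (d - 1) w hw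
  refine ⟨w, ?_⟩
  intro t ht E _ _ _ hE χ' hχ'
  have hsum : (∑ x : E, χ' (Polynomial.aeval x f)) = -∑ j : Fin (d - 1), w j ^ t := by
    rw [← hw t ht, ← wm_point_sum χ f t ht E hE]
    exact Finset.sum_congr rfl (fun x _ => hχ' _)
  refine ⟨hsum, ?_⟩
  rw [hsum, norm_neg]
  refine (norm_sum_le _ _).trans ?_
  have h1 : ∀ j ∈ (Finset.univ : Finset (Fin (d - 1))),
      ‖w j ^ t‖ ≤ Real.sqrt ((Fintype.card F : ℝ) ^ t) := by
    intro j _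
    rw [norm_pow]
    apply Real.le_sqrt_of_sq_le
    have h2 : ‖w j‖ ^ 2 ≤ (Fintype.card F : ℝ) := by
      have := pow_le_pow_left₀ (norm_nonneg _) (hwb j) 2
      rwa [Real.sq_sqrt (by positivity)] at this
    rw [← pow_mul, mul_comm, pow_mul]
    exact pow_le_pow_left₀ (by positivity) h2 t
  refine (Finset.sum_le_card_nsmul _ _ _ h1).trans ?_
  rw [Finset.card_univ, Fintype.card_fin, nsmul_eq_mul, Nat.cast_sub (by omega), Nat.cast_one]
end
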